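/- arXiv:1611.03435 — 7 statements merged into one kernel-verified Lean document; each statement's English description precedes it below -/
import Mathlib

section
/- Let T > 0. Let u, a, b : [0,T] → ℝ be nonnegative continuous functions with a and b nondecreasing, and let k be a nonnegative continuous function on the triangle {(s,r) : 0 ≤ r ≤ s ≤ T}. If u(t) ≤ a(t) + b(t)·∫₀ᵗ ∫₀ˢ k(s,r) u(r) dr ds for all t ∈ [0,T], then u(t) ≤ a(t)·exp( b(t)·∫₀ᵗ ∫₀ˢ k(s,r) dr ds ) for all t ∈ [0,T]. -/
open Set intervalIntegral

/-- A function continuous on the triangle `{0 ≤ r ≤ s ≤ T}` has a continuous partial integral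
`s ↦ ∫₀ˢ h(s,r) dr` on `[0,T]`, which extends continuously to the whole line. -/
theorem exists_continuous_eq_integral_triangle {T : ℝ} (hT : 0 ≤ T) {h : ℝ → ℝ → ℝ}
    (hh : ContinuousOn (fun p : ℝ × ℝ => h p.1 p.2)
      {p : ℝ × ℝ | 0 ≤ p.2 ∧ p.2 ≤ p.1 ∧ p.1 ≤ T}) :
    ∃ G : ℝ → ℝ, Continuous G ∧ ∀ s ∈ Icc (0 : ℝ) T, G s = ∫ r in (0 : ℝ)..s, h s r := by
  let c : ℝ → ℝ := fun s => max 0 (min s T)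
  let H : ℝ → ℝ → ℝ := fun s r => h (c s) (max 0 (min r (c s)))
  have hH : Continuous (Function.uncurry H) := by
    refine hh.comp_continuous (f := fun p : ℝ × ℝ => (c p.1, max 0 (min p.2 (c p.1))))
      (by fun_prop) fun p => ⟨le_max_left _ _, ?_, ?_⟩
    · exact max_le (le_max_left _ _) (min_le_right _ _)
    · exact max_le hT (min_le_right _ _)
  refine ⟨fun s => ∫ r in (0 : ℝ)..s, H s r,
    continuous_parametric_intervalIntegral_of_continuous hH continuous_id, fun s hs => ?_⟩
  refine integral_congr fun r hr => ?_
  rw [uIcc_of_le hs.1] at hr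
  have hc : c s = s := by simp [c, hs.1, hs.2]
  simp only [H, hc, min_eq_left hr.2, max_eq_right hr.1]

/-- Gronwall's inequality for an integral function: if `B * g ≤ B * κ * w` on `[0,t]`, where
`w = A + B ∫₀ g`, then `w(t) ≤ A * exp (B ∫₀ᵗ κ)`. -/
theorem add_mul_integral_le_mul_exp {A B t : ℝ} {g κ : ℝ → ℝ} (ht : 0 ≤ t)
    (hg : Continuous g) (hκ : Continuous κ)
    (hle : ∀ s ∈ Icc 0 t, B * g s ≤ B * κ s * (A + B * ∫ x in (0 : ℝ)..s, g x)) :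
    A + B * ∫ s in (0 : ℝ)..t, g s ≤ A * Real.exp (B * ∫ s in (0 : ℝ)..t, κ s) := by
  let F : ℝ → ℝ := fun s =>
    (A + B * ∫ x in (0 : ℝ)..s, g x) * Real.exp (-(B * ∫ x in (0 : ℝ)..s, κ x))
  have hF (s : ℝ) : HasDerivAt F
      ((B * g s) * Real.exp (-(B * ∫ x in (0 : ℝ)..s, κ x)) +
        (A + B * ∫ x in (0 : ℝ)..s, g x) *
          (Real.exp (-(B * ∫ x in (0 : ℝ)..s, κ x)) * -(B * κ s))) s :=
    (((hg.integral_hasStrictDerivAt 0 s).hasDerivAt.const_mul B).const_add A).mul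
      (((hκ.integral_hasStrictDerivAt 0 s).hasDerivAt.const_mul B).neg.exp)
  have hanti : AntitoneOn F (Icc 0 t) := by
    refine antitoneOn_of_deriv_nonpos (convex_Icc 0 t)
      (fun s _ => (hF s).continuousAt.continuousWithinAt)
      (fun s _ => (hF s).differentiableAt.differentiableWithinAt) fun s hs => ?_
    rw [(hF s).deriv]
    have := mul_le_mul_of_nonneg_right (hle s (interior_subset hs))
      (Real.exp_pos (-(B * ∫ x in (0 : ℝ)..s, κ x))).le
    linarith
  have h0 : F t ≤ A := by
    simpa [F] using hanti (left_mem_Icc.2 ht) (right_mem_Icc.2 ht) ht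
  simpa only [F, Real.exp_neg, ← div_eq_mul_inv, div_le_iff₀ (Real.exp_pos _)] using h0

/-- Iterated-integral version of Gronwall's inequality (Bainov–Simeonov):
if `u(t) ≤ a(t) + b(t)∫₀ᵗ∫₀ˢ k(s,r)u(r) dr ds` on `[0,T]` with `u,a,b ≥ 0`
continuous, `a,b` nondecreasing, and `k ≥ 0` continuous on the triangle
`{0 ≤ r ≤ s ≤ T}`, then `u(t) ≤ a(t)·exp(b(t)∫₀ᵗ∫₀ˢ k(s,r) dr ds)` on `[0,T]`. -/
theorem stmt_0 (T : ℝ) (hT : 0 < T) (u a b : ℝ → ℝ) (k : ℝ → ℝ → ℝ)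
    (hu_cont : ContinuousOn u (Icc 0 T))
    (ha_cont : ContinuousOn a (Icc 0 T))
    (hb_cont : ContinuousOn b (Icc 0 T))
    (hu_nonneg : ∀ t ∈ Icc (0 : ℝ) T, 0 ≤ u t)
    (ha_nonneg : ∀ t ∈ Icc (0 : ℝ) T, 0 ≤ a t)
    (hb_nonneg : ∀ t ∈ Icc (0 : ℝ) T, 0 ≤ b t)
    (ha_mono : MonotoneOn a (Icc 0 T))
    (hb_mono : MonotoneOn b (Icc 0 T))
    (hk_cont : ContinuousOn (fun p : ℝ × ℝ => k p.1 p.2)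
      {p : ℝ × ℝ | 0 ≤ p.2 ∧ p.2 ≤ p.1 ∧ p.1 ≤ T})
    (hk_nonneg : ∀ s r : ℝ, 0 ≤ r → r ≤ s → s ≤ T → 0 ≤ k s r)
    (hineq : ∀ t ∈ Icc (0 : ℝ) T,
      u t ≤ a t + b t * ∫ s in (0 : ℝ)..t, ∫ r in (0 : ℝ)..s, k s r * u r) :
    ∀ t ∈ Icc (0 : ℝ) T,
      u t ≤ a t * Real.exp (b t * ∫ s in (0 : ℝ)..t, ∫ r in (0 : ℝ)..s, k s r) := by
  intro t ht
  obtain ⟨g, hg, hg_eq⟩ := exists_continuous_eq_integral_triangle hT.le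
    (h := fun s r => k s r * u r) (hk_cont.mul (hu_cont.comp continuousOn_snd
      fun p hp => ⟨hp.1, hp.2.1.trans hp.2.2⟩))
  obtain ⟨κ, hκ, hκ_eq⟩ := exists_continuous_eq_integral_triangle hT.le hk_cont
  have hg_int : ∀ s ∈ Icc (0 : ℝ) T,
      ∫ x in (0 : ℝ)..s, ∫ r in (0 : ℝ)..x, k x r * u r = ∫ x in (0 : ℝ)..s, g x := by
    refine fun s hs => integral_congr fun x hx => (hg_eq x ?_).symm
    rw [uIcc_of_le hs.1] at hx
    exact ⟨hx.1, hx.2.trans hs.2⟩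
  have hκ_int : ∫ x in (0 : ℝ)..t, ∫ r in (0 : ℝ)..x, k x r = ∫ x in (0 : ℝ)..t, κ x := by
    refine integral_congr fun x hx => (hκ_eq x ?_).symm
    rw [uIcc_of_le ht.1] at hx
    exact ⟨hx.1, hx.2.trans ht.2⟩
  have hg_nonneg : ∀ s ∈ Icc (0 : ℝ) T, 0 ≤ g s := fun s hs => by
    rw [hg_eq s hs]
    exact integral_nonneg hs.1 fun r hr =>
      mul_nonneg (hk_nonneg s r hr.1 hr.2 hs.2) (hu_nonneg r ⟨hr.1, hr.2.trans hs.2⟩)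
  have hB := hb_nonneg t ht
  have hu_le : ∀ s ∈ Icc 0 t, ∀ r ∈ Icc 0 s, u r ≤ a t + b t * ∫ x in (0 : ℝ)..s, g x := by
    intro s hs r hr
    have hrt : r ≤ t := hr.2.trans hs.2
    have hrT : r ∈ Icc 0 T := ⟨hr.1, hrt.trans ht.2⟩
    have hmono : ∫ x in (0 : ℝ)..r, g x ≤ ∫ x in (0 : ℝ)..s, g x := by
      rw [← integral_add_adjacent_intervals (hg.intervalIntegrable 0 r)
        (hg.intervalIntegrable r s)]
      exact le_add_of_nonneg_right (integral_nonneg hr.2 fun x hx =>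
        hg_nonneg x ⟨hr.1.trans hx.1, hx.2.trans (hs.2.trans ht.2)⟩)
    have hr_nonneg : 0 ≤ ∫ x in (0 : ℝ)..r, g x :=
      integral_nonneg hr.1 fun x hx => hg_nonneg x ⟨hx.1, hx.2.trans hrT.2⟩
    calc u r ≤ a r + b r * ∫ x in (0 : ℝ)..r, g x := hg_int r hrT ▸ hineq r hrT
      _ ≤ a t + b t * ∫ x in (0 : ℝ)..s, g x :=
        add_le_add (ha_mono hrT ht hrt) (mul_le_mul (hb_mono hrT ht hrt) hmono hr_nonneg hB)
  rw [hκ_int]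
  refine (hu_le t (right_mem_Icc.2 ht.1) t (right_mem_Icc.2 ht.1)).trans
    (add_mul_integral_le_mul_exp ht.1 hg hκ fun s hs => ?_)
  have hsT : s ∈ Icc 0 T := ⟨hs.1, hs.2.trans ht.2⟩
  rw [mul_assoc, hg_eq s hsT, hκ_eq s hsT, ← integral_mul_const]
  have hk_slice : ContinuousOn (k s) (Icc 0 s) :=
    hk_cont.comp (f := fun r => (s, r)) (by fun_prop) fun r hr => ⟨hr.1, hr.2, hsT.2⟩
  have hu_slice : ContinuousOn u (Icc 0 s) := hu_cont.mono (Icc_subset_Icc_right hsT.2)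
  refine mul_le_mul_of_nonneg_left (integral_mono_on hs.1
    ((hk_slice.mul hu_slice).intervalIntegrable_of_Icc hs.1)
    ((hk_slice.mul continuousOn_const).intervalIntegrable_of_Icc hs.1) fun r hr => ?_) hB
  exact mul_le_mul_of_nonneg_left (hu_le s hs r hr) (hk_nonneg s r hr.1 hr.2 hsT.2)
end

section
/- Let T > 0, η > 0, γ ≥ 0, and let λ, ρ : [0,T] → [0,∞) be continuous. Let A, B, C : [0,T) → ℝ be continuously differentiable and satisfy, for all t ∈ [0,T), A'(t) = −λ(t) + η⁻¹(A(t) − γB(t))², B'(t) = ρ(t)B(t) − η⁻¹(γC(t) − B(t) + 1)(A(t) − γB(t)), C'(t) = 2ρ(t)C(t) + η⁻¹(γC(t) − B(t) + 1)², together with A(t) → +∞, B(t) → 1 and C(t) → 0 as t → T. Set D := η⁻¹(A − γB) and E := η⁻¹(γC − B + 1). Then for all t ∈ [0,T): A(t) ≥ 0, D(t) ≥ 0, 0 ≤ B(t) ≤ 1, −1 ≤ γ·C(t) ≤ 0, and 0 ≤ η·E(t) ≤ 1. -/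
open Set Filter

/-- Grönwall's inequality for a linear differential inequality with variable coefficient. -/
theorem le_exp_integral_mul_of_hasDerivAt_le {a b : ℝ} (hab : a ≤ b) {f f' k : ℝ → ℝ}
    (hk : ContinuousOn k (Icc a b)) (hf : ContinuousOn f (Icc a b))
    (hf' : ∀ t ∈ Ioo a b, HasDerivAt f (f' t) t)
    (hle : ∀ t ∈ Ioo a b, f' t ≤ k t * f t) :
    f b ≤ Real.exp (∫ t in a..b, k t) * f a := by
  set κ : ℝ → ℝ := IccExtend hab ((Icc a b).domRestrict k)
  have hκc : Continuous κ := hk.domRestrict.Icc_extend'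
  have hκk : ∀ t ∈ Icc a b, κ t = k t := fun t ht => IccExtend_of_mem hab _ ht
  have hK : ∀ t, HasDerivAt (fun s => ∫ u in a..s, κ u) (κ t) t := fun t =>
    hκc.integral_hasStrictDerivAt a t |>.hasDerivAt
  have hKc : Continuous (fun s => ∫ u in a..s, κ u) :=
    continuous_iff_continuousAt.2 fun t => (hK t).continuousAt
  have hder : ∀ t ∈ Ioo a b, HasDerivAt (fun s => f s * Real.exp (-∫ u in a..s, κ u))
      (f' t * Real.exp (-∫ u in a..t, κ u) +
        f t * (Real.exp (-∫ u in a..t, κ u) * -κ t)) t :=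
    fun t ht => (hf' t ht).mul (hK t).neg.exp
  have hanti : AntitoneOn (fun s => f s * Real.exp (-∫ u in a..s, κ u)) (Icc a b) := by
    refine antitoneOn_of_deriv_nonpos (convex_Icc a b)
      (hf.mul (Real.continuous_exp.comp hKc.neg).continuousOn) ?_ ?_ <;>
      rw [interior_Icc] <;> intro t ht
    · exact (hder t ht).differentiableAt.differentiableWithinAt
    · rw [(hder t ht).deriv, hκk t (Ioo_subset_Icc_self ht)]
      have h := mul_le_mul_of_nonneg_right (hle t ht)
        (Real.exp_pos (-∫ u in a..t, κ u)).le
      linarith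
  have h := hanti (left_mem_Icc.2 hab) (right_mem_Icc.2 hab) hab
  have hint : ∫ u in a..b, κ u = ∫ u in a..b, k u :=
    intervalIntegral.integral_congr fun t ht => hκk t (by rwa [uIcc_of_le hab] at ht)
  simp only [intervalIntegral.integral_same, neg_zero, Real.exp_zero, mul_one, hint] at h
  calc f b = Real.exp (∫ u in a..b, k u) * (f b * Real.exp (-∫ u in a..b, k u)) := by
        rw [mul_left_comm, ← Real.exp_add, add_neg_cancel, Real.exp_zero, mul_one]
    _ ≤ _ := mul_le_mul_of_nonneg_left h (Real.exp_pos _).le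

/-- A solution of `f' ≤ k f` on `[a, T)` whose lower limit at `T` is nonnegative is nonnegative,
provided `k` is nonnegative near `T`. -/
theorem nonneg_of_hasDerivAt_le_of_eventually {a T : ℝ} {f f' k : ℝ → ℝ}
    (hk : ContinuousOn k (Ico a T)) (hf : ContinuousOn f (Ico a T))
    (hf' : ∀ t ∈ Ioo a T, HasDerivAt f (f' t) t)
    (hle : ∀ t ∈ Ioo a T, f' t ≤ k t * f t)
    (hkT : ∀ᶠ t in nhdsWithin T (Iio T), 0 ≤ k t)
    (hfT : ∀ ε > 0, ∀ᶠ t in nhdsWithin T (Iio T), -ε < f t) :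
    ∀ t ∈ Ico a T, 0 ≤ f t := by
  intro t ht
  by_contra! hneg
  have key : ∀ s r, a ≤ s → s ≤ r → r < T → f r ≤ Real.exp (∫ u in s..r, k u) * f s := by
    intro s r has hsr hrT
    have hsub : Icc s r ⊆ Ico a T := fun u hu => ⟨has.trans hu.1, hu.2.trans_lt hrT⟩
    have hsub' : Ioo s r ⊆ Ioo a T := fun u hu => ⟨has.trans_lt hu.1, hu.2.trans hrT⟩
    exact le_exp_integral_mul_of_hasDerivAt_le hsr (hk.mono hsub) (hf.mono hsub)
      (fun u hu => hf' u (hsub' hu)) (fun u hu => hle u (hsub' hu))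
  obtain ⟨l, hlT, hl⟩ := (mem_nhdsLT_iff_exists_Ioo_subset' ht.2).1 hkT
  obtain ⟨s, hs, hsT⟩ := exists_between (max_lt ht.2 hlT)
  obtain ⟨hts, hls⟩ := max_lt_iff.1 hs
  have hfs : f s < 0 :=
    (key t s ht.1 hts.le hsT).trans_lt (mul_neg_of_pos_of_neg (Real.exp_pos _) hneg)
  obtain ⟨r, hr, hsr, hrT⟩ :=
    ((hfT (-f s) (neg_pos.2 hfs)).and (Ioo_mem_nhdsLT hsT)).exists
  have hint : 0 ≤ ∫ u in s..r, k u :=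
    intervalIntegral.integral_nonneg hsr.le fun u hu =>
      hl ⟨hls.trans_le hu.1, hu.2.trans_lt hrT⟩
  have := key s r (ht.1.trans hts.le) hsr.le hrT
  nlinarith [Real.one_le_exp hint]

/-- Sign and range estimates for the deterministic Riccati system of the
optimal execution problem: any solution `(A,B,C)` on `[0,T)` with
`(A,B,C) → (∞,1,0)` at `T` satisfies `A, D ≥ 0`, `B, −γC, ηE ∈ [0,1]`,
where `D = η⁻¹(A − γB)` and `E = η⁻¹(γC − B + 1)`. -/
theorem stmt_4 (T η γ : ℝ) (hT : 0 < T) (hη : 0 < η) (hγ : 0 ≤ γ)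
    (lam ρ : ℝ → ℝ)
    (hlam_cont : ContinuousOn lam (Icc 0 T))
    (hlam_nonneg : ∀ t ∈ Icc (0 : ℝ) T, 0 ≤ lam t)
    (hρ_cont : ContinuousOn ρ (Icc 0 T))
    (hρ_nonneg : ∀ t ∈ Icc (0 : ℝ) T, 0 ≤ ρ t)
    (A B C : ℝ → ℝ)
    (hA : ∀ t ∈ Ico (0 : ℝ) T, HasDerivWithinAt A
      (-lam t + η⁻¹ * (A t - γ * B t) ^ 2) (Ico 0 T) t)
    (hB : ∀ t ∈ Ico (0 : ℝ) T, HasDerivWithinAt B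
      (ρ t * B t - η⁻¹ * (γ * C t - B t + 1) * (A t - γ * B t)) (Ico 0 T) t)
    (hC : ∀ t ∈ Ico (0 : ℝ) T, HasDerivWithinAt C
      (2 * ρ t * C t + η⁻¹ * (γ * C t - B t + 1) ^ 2) (Ico 0 T) t)
    (hAT : Tendsto A (nhdsWithin T (Iio T)) atTop)
    (hBT : Tendsto B (nhdsWithin T (Iio T)) (nhds 1))
    (hCT : Tendsto C (nhdsWithin T (Iio T)) (nhds 0)) :
    ∀ t ∈ Ico (0 : ℝ) T,
      0 ≤ A t
      ∧ 0 ≤ η⁻¹ * (A t - γ * B t)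
      ∧ 0 ≤ B t ∧ B t ≤ 1
      ∧ -1 ≤ γ * C t ∧ γ * C t ≤ 0
      ∧ 0 ≤ η * (η⁻¹ * (γ * C t - B t + 1))
      ∧ η * (η⁻¹ * (γ * C t - B t + 1)) ≤ 1 := by
  have hAc : ContinuousOn A (Ico 0 T) := fun t ht => (hA t ht).continuousWithinAt
  have hBc : ContinuousOn B (Ico 0 T) := fun t ht => (hB t ht).continuousWithinAt
  have hCc : ContinuousOn C (Ico 0 T) := fun t ht => (hC t ht).continuousWithinAt
  have hρc : ContinuousOn ρ (Ico 0 T) := hρ_cont.mono Ico_subset_Icc_self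
  have hρ0 : ∀ t ∈ Ico 0 T, 0 ≤ ρ t := fun t ht => hρ_nonneg t (Ico_subset_Icc_self ht)
  have hη' : 0 < η⁻¹ := inv_pos.2 hη
  have hIoo : ∀ {t}, t ∈ Ioo 0 T → t ∈ Ico 0 T := fun ht => Ioo_subset_Ico_self ht
  have hnhds : ∀ {t}, t ∈ Ioo 0 T → Ico 0 T ∈ nhds t := fun ht => Ico_mem_nhds ht.1 ht.2
  have hnear : ∀ᶠ t in nhdsWithin T (Iio T), t ∈ Ioo 0 T := Ioo_mem_nhdsLT hT
  have hC0 : ∀ t ∈ Ico 0 T, 0 ≤ -C t := by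
    refine nonneg_of_hasDerivAt_le_of_eventually (k := fun t => 2 * ρ t)
      (continuousOn_const.mul hρc) hCc.neg
      (fun t ht => ((hC t (hIoo ht)).hasDerivAt (hnhds ht)).neg) ?_ ?_ ?_
    · intro t _
      have := mul_nonneg hη'.le (sq_nonneg (γ * C t - B t + 1))
      linarith
    · filter_upwards [hnear] with t ht
      exact mul_nonneg zero_le_two (hρ0 t (hIoo ht))
    · intro ε hε
      exact hCT.neg.eventually_const_lt (by linarith)
  have hFT : Tendsto (fun t => γ * C t - B t + 1) (nhdsWithin T (Iio T)) (nhds 0) := by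
    have := ((hCT.const_mul γ).sub hBT).add_const 1
    simpa using this
  have hGT : Tendsto (fun t => A t - γ * B t) (nhdsWithin T (Iio T)) atTop := by
    simpa only [sub_eq_add_neg] using hAT.atTop_add (hBT.const_mul γ).neg
  have hFc : ContinuousOn (fun t => γ * C t - B t + 1) (Ico 0 T) := by fun_prop
  have hGc : ContinuousOn (fun t => A t - γ * B t) (Ico 0 T) := by fun_prop
  have hcoefT : ∀ᶠ t in nhdsWithin T (Iio T),
      0 ≤ γ * (γ * C t - B t + 1) + (A t - γ * B t) :=
    ((hFT.const_mul γ).add_atTop hGT).eventually_ge_atTop 0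
  have hF0 : ∀ t ∈ Ico 0 T, 0 ≤ γ * C t - B t + 1 := by
    refine nonneg_of_hasDerivAt_le_of_eventually
      (k := fun t => ρ t + η⁻¹ * (γ * (γ * C t - B t + 1) + (A t - γ * B t)))
      (by fun_prop) hFc
      (fun t ht => ((((hC t (hIoo ht)).hasDerivAt (hnhds ht)).const_mul γ).sub
        ((hB t (hIoo ht)).hasDerivAt (hnhds ht))).add_const 1) ?_ ?_ ?_
    · intro t ht
      have h1 := mul_nonneg (hρ0 t (hIoo ht)) (mul_nonneg hγ (hC0 t (hIoo ht)))
      have h2 := hρ0 t (hIoo ht)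
      linarith
    · filter_upwards [hnear, hcoefT] with t ht h
      exact add_nonneg (hρ0 t (hIoo ht)) (mul_nonneg hη'.le h)
    · intro ε hε
      exact hFT.eventually_const_lt (by linarith)
  have hG0 : ∀ s ∈ Ico 0 T, (∀ t ∈ Ioo s T, 0 ≤ B t) →
      ∀ t ∈ Ico s T, 0 ≤ A t - γ * B t := by
    intro s hs hBs
    have hsub : Ico s T ⊆ Ico 0 T := Ico_subset_Ico_left hs.1
    have hsub' : Ioo s T ⊆ Ioo 0 T := Ioo_subset_Ioo_left hs.1
    refine nonneg_of_hasDerivAt_le_of_eventually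
      (k := fun t => η⁻¹ * (γ * (γ * C t - B t + 1) + (A t - γ * B t)))
      (ContinuousOn.mono (by fun_prop) hsub) (hGc.mono hsub)
      (fun t ht => ((hA t (hIoo (hsub' ht))).hasDerivAt (hnhds (hsub' ht))).sub
        (((hB t (hIoo (hsub' ht))).hasDerivAt (hnhds (hsub' ht))).const_mul γ)) ?_ ?_ ?_
    · intro t ht
      have h1 := mul_nonneg hγ (mul_nonneg (hρ0 t (hIoo (hsub' ht))) (hBs t ht))
      have h2 := hlam_nonneg t (Ioo_subset_Icc_self (hsub' ht))
      linarith
    · filter_upwards [hcoefT] with t h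
      exact mul_nonneg hη'.le h
    · intro ε _
      exact hGT.eventually_gt_atTop (-ε)
  have hB0 : ∀ t ∈ Ico 0 T, 0 ≤ B t := by
    intro t ht
    by_contra! hneg
    obtain ⟨l, hlT, hl⟩ := (mem_nhdsLT_iff_exists_Ioo_subset' ht.2).1
      (hBT.eventually_const_lt (zero_lt_one' ℝ))
    obtain ⟨m, hm, hmT⟩ := exists_between (max_lt ht.2 hlT)
    obtain ⟨htm, hlm⟩ := max_lt_iff.1 hm
    have hpos : ∀ u ∈ Ico m T, 0 < B u := fun u hu => hl ⟨hlm.trans_le hu.1, hu.2⟩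
    have hsub : Icc t m ⊆ Ico 0 T := fun u hu => ⟨ht.1.trans hu.1, hu.2.trans_lt hmT⟩
    -- `s` is the last time in `[t, m]` at which `B` is nonpositive.
    have hcpt : IsCompact (Icc t m ∩ B ⁻¹' Iic 0) :=
      isCompact_Icc.of_isClosed_subset
        ((hBc.mono hsub).preimage_isClosed_of_isClosed isClosed_Icc isClosed_Iic)
        inter_subset_left
    obtain ⟨s, ⟨hs, hBs⟩, hmax⟩ := hcpt.exists_isGreatest ⟨t, ⟨le_rfl, htm.le⟩, hneg.le⟩
    have hBpos : ∀ u ∈ Ioo s T, 0 < B u := by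
      intro u hu
      rcases le_total m u with hmu | hum
      · exact hpos u ⟨hmu, hu.2⟩
      · by_contra! hle
        exact (hmax ⟨⟨hs.1.trans hu.1.le, hum⟩, hle⟩).not_gt hu.1
    have hGs := hG0 s (hsub hs) fun u hu => (hBpos u hu).le
    have hsub2 : Icc s m ⊆ Ico 0 T := (Icc_subset_Icc_left hs.1).trans hsub
    have hsub2' : Ioo s m ⊆ Ioo 0 T := Ioo_subset_Ioo (ht.1.trans hs.1) hmT.le
    have hBm := le_exp_integral_mul_of_hasDerivAt_le hs.2 (hρc.mono hsub2) (hBc.mono hsub2)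
      (fun u hu => (hB u (hIoo (hsub2' hu))).hasDerivAt (hnhds (hsub2' hu)))
      (fun u hu => sub_le_self _ (mul_nonneg (mul_nonneg hη'.le (hF0 u (hIoo (hsub2' hu))))
        (hGs u ⟨hu.1.le, hu.2.trans hmT⟩)))
    have := mul_nonpos_of_nonneg_of_nonpos
      (Real.exp_pos (∫ u in s..m, ρ u)).le (mem_Iic.1 hBs)
    linarith [hpos m ⟨le_rfl, hmT⟩]
  intro t ht
  have hGt := hG0 0 ⟨le_rfl, hT⟩ (fun u hu => hB0 u (hIoo hu)) t ht
  have hBt := hB0 t ht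
  have hFt := hF0 t ht
  have hγC := mul_nonneg hγ (hC0 t ht)
  have hγB := mul_nonneg hγ hBt
  rw [mul_inv_cancel_left₀ hη.ne']
  exact ⟨by linarith, mul_nonneg hη'.le hGt, hBt, by linarith, by linarith, by linarith, hFt,
    by linarith⟩
end

section
/- Let T > 0, η > 0, γ > 0, and let λ, ρ : [0,T] → [0,∞) be continuous. Let A, B, C : [0,T) → ℝ be continuously differentiable and satisfy, for all t ∈ [0,T), A'(t) = −λ(t) + η⁻¹(A(t) − γB(t))², B'(t) = ρ(t)B(t) − η⁻¹(γC(t) − B(t) + 1)(A(t) − γB(t)), C'(t) = 2ρ(t)C(t) + η⁻¹(γC(t) − B(t) + 1)², together with A(t) → +∞, B(t) → 1 and C(t) → 0 as t → T. Set D := η⁻¹(A − γB), E := η⁻¹(γC − B + 1), and κ := sqrt(2·η⁻¹·max{sup_{[0,T]} λ, γ·sup_{[0,T]} ρ}), and assume κ > 0. Then for all t ∈ [0,T): (η⁻¹γ)/(exp(η⁻¹γ(T−t)) − 1) ≤ D(t) ≤ κ·coth(κ(T−t)), exp(−(sup_{[0,T]} ρ)·(T−t)) ≤ B(t) ≤ 1,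 and 0 ≤ E(t) ≤ γ⁻¹·κ·tanh(κ(T−t)). -/
open Set Filter

/-- A function on `[s, T)` with nonnegative lower limit at `T` is nonnegative if, wherever it is
negative, its derivative is at most `g * w` for some `g` bounded below. -/
theorem nonneg_of_deriv_le_mul {s T K : ℝ} {w w' g : ℝ → ℝ}
    (hw : ∀ t ∈ Ico s T, HasDerivWithinAt w (w' t) (Ico s T) t)
    (hle : ∀ t ∈ Ico s T, w t < 0 → w' t ≤ g t * w t)
    (hg : ∀ t ∈ Ico s T, K ≤ g t)
    (hlim : ∀ ε > 0, ∀ᶠ t in nhdsWithin T (Iio T), -ε ≤ w t) :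
    ∀ t ∈ Ico s T, 0 ≤ w t := by
  intro t₀ ht₀
  by_contra! hneg
  set v : ℝ → ℝ := fun t => Real.exp (-K * t) * w t with hv
  have hexp : ∀ t, HasDerivAt (fun t => Real.exp (-K * t)) (Real.exp (-K * t) * -K) t := fun t => by
    simpa using ((hasDerivAt_id t).const_mul (-K)).exp
  have hvd : ∀ t ∈ Ico s T, HasDerivWithinAt v
      (Real.exp (-K * t) * -K * w t + Real.exp (-K * t) * w' t) (Ico s T) t := fun t ht =>
    (hexp t).hasDerivWithinAt.mul (hw t ht)
  have hv₀ : v t₀ < 0 := mul_neg_of_pos_of_neg (Real.exp_pos _) hneg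
  have hTt : 0 < T - t₀ := sub_pos.2 ht₀.2
  set δ := -v t₀ / (2 * (T - t₀)) with hδ
  have hδpos : 0 < δ := div_pos (by linarith) (by linarith)
  have hδeq : δ * (T - t₀) = -v t₀ / 2 := by rw [hδ]; field_simp
  have hbound : ∀ t ∈ Ico t₀ T, v t ≤ v t₀ / 2 := by
    intro b hb
    have hsub : Icc t₀ b ⊆ Ico s T := fun x hx =>
      ⟨ht₀.1.trans hx.1, hx.2.trans_lt hb.2⟩
    have hlin : ∀ x ∈ Icc t₀ b, v t₀ + δ * (x - t₀) ≤ v t₀ / 2 := by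
      intro x hx
      have : δ * (x - t₀) ≤ δ * (T - t₀) := by
        gcongr
        exact hx.2.trans hb.2.le
      linarith
    have key := image_le_of_deriv_right_lt_deriv_boundary (f := v) (a := t₀) (b := b)
      (f' := fun t => Real.exp (-K * t) * -K * w t + Real.exp (-K * t) * w' t)
      (B := fun x => v t₀ + δ * (x - t₀)) (B' := fun _ => δ)
      (fun x hx => ((hvd x (hsub hx)).continuousWithinAt).mono hsub)
      (fun x hx => (hvd x (hsub (Ico_subset_Icc_self hx))).mono_of_mem_nhdsWithin
        (mem_of_superset (Ico_mem_nhdsGE hx.2)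
          (fun y hy => hsub ⟨hx.1.trans hy.1, hy.2.le⟩)))
      (by simp)
      (fun x => by
        simpa using (((hasDerivAt_id x).sub_const t₀).const_mul δ).const_add (v t₀))
      (fun x hx hxeq => by
        have hxs := hsub (Ico_subset_Icc_self hx)
        have hvx : v x < 0 := by
          have := hlin x (Ico_subset_Icc_self hx)
          linarith
        have hwx : w x < 0 := by
          by_contra! h
          exact absurd hvx (not_lt.2 (mul_nonneg (Real.exp_pos _).le h))
        have h1 : w' x ≤ K * w x :=
          (hle x hxs hwx).trans (mul_le_mul_of_nonpos_right (hg x hxs) hwx.le)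
        have h2 := mul_le_mul_of_nonneg_left h1 (Real.exp_pos (-K * x)).le
        linarith)
    exact (key ⟨hb.1, le_rfl⟩).trans (hlin b ⟨hb.1, le_rfl⟩)
  have hM : ContinuousAt (fun t => Real.exp (-K * t)) T := (hexp T).continuousAt
  have hM' : ∀ᶠ t in nhdsWithin T (Iio T), Real.exp (-K * t) < Real.exp (-K * T) + 1 :=
    (hM.eventually (gt_mem_nhds (lt_add_one _))).filter_mono nhdsWithin_le_nhds
  set M := Real.exp (-K * T) + 1 with hMdef
  have hMpos : 0 < M := by positivity
  have hε : 0 < -v t₀ / (4 * M) := div_pos (by linarith) (by linarith)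
  obtain ⟨t, h1, h2, h3⟩ := ((hlim _ hε).and (hM'.and (Ico_mem_nhdsLT ht₀.2))).exists
  have h4 := hbound t h3
  have hMε : M * (-v t₀ / (4 * M)) = -v t₀ / 4 := by field_simp
  have h5 : -(M * (-v t₀ / (4 * M))) ≤ v t := by
    have e1 : Real.exp (-K * t) * (-(-v t₀ / (4 * M))) ≤ v t :=
      mul_le_mul_of_nonneg_left h1 (Real.exp_pos _).le
    have e2 := mul_le_mul_of_nonneg_right h2.le hε.le
    linarith
  linarith

/-- A continuous function on `[a, T)` that is positive near `T` but not everywhere has a last zero. -/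
theorem exists_last_zero {a T : ℝ} {f : ℝ → ℝ} (hf : ContinuousOn f (Ico a T))
    (hpos : ∀ᶠ t in nhdsWithin T (Iio T), 0 < f t) {t₀ : ℝ} (ht₀ : t₀ ∈ Ico a T)
    (hneg : f t₀ ≤ 0) :
    ∃ s ∈ Ico a T, f s = 0 ∧ ∀ t ∈ Ico s T, 0 ≤ f t := by
  obtain ⟨l, hl, hlT⟩ := (mem_nhdsLT_iff_exists_Ioo_subset).1 hpos
  obtain ⟨b, hb, hbT⟩ := exists_between (max_lt hl ht₀.2)
  obtain ⟨hlb, htb⟩ := max_lt_iff.1 hb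
  have hsub : Icc t₀ b ⊆ Ico a T := fun x hx => ⟨ht₀.1.trans hx.1, hx.2.trans_lt hbT⟩
  have hcomp : IsCompact (Icc t₀ b ∩ f ⁻¹' Iic 0) :=
    isCompact_Icc.of_isClosed_subset
      ((hf.mono hsub).preimage_isClosed_of_isClosed isClosed_Icc isClosed_Iic) inter_subset_left
  obtain ⟨s, ⟨hs, hfs⟩, hmax⟩ := hcomp.exists_isGreatest ⟨t₀, ⟨le_rfl, htb.le⟩, hneg⟩
  have hafter : ∀ t ∈ Ioo s T, 0 < f t := by
    intro t ht
    rcases lt_or_ge b t with hbt | hbt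
    · exact hlT ⟨hlb.trans hbt, ht.2⟩
    · by_contra! h
      exact absurd (hmax ⟨⟨hs.1.trans ht.1.le, hbt⟩, h⟩) (not_le.2 ht.1)
  have hfs0 : f s = 0 := by
    refine le_antisymm hfs ?_
    by_contra! h
    have hfb : 0 < f b := hlT ⟨hlb, hbT⟩
    obtain ⟨c, hc, hfc⟩ := intermediate_value_Icc hs.2
      (hf.mono ((Icc_subset_Icc_left hs.1).trans hsub))
      (show (0 : ℝ) ∈ Icc (f s) (f b) from ⟨h.le, hfb.le⟩)
    have : s < c := lt_of_le_of_ne hc.1 (by rintro rfl; linarith)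
    exact absurd (hafter c ⟨this, hc.2.trans_lt hbT⟩) (by simp [hfc])
  refine ⟨s, hsub hs, hfs0, fun t ht => ?_⟩
  rcases eq_or_lt_of_le ht.1 with rfl | h
  · exact hfs0.ge
  · exact (hafter t ⟨h, ht.2⟩).le

theorem exists_lower_bound_of_tendsto_atTop {a T : ℝ} {f : ℝ → ℝ} (hf : ContinuousOn f (Ico a T))
    (hlim : Tendsto f (nhdsWithin T (Iio T)) atTop) : ∃ K, ∀ t ∈ Ico a T, K ≤ f t := by
  rcases le_or_gt T a with h | h
  · exact ⟨0, fun t ht => absurd (ht.1.trans_lt ht.2) (not_lt.2 h)⟩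
  obtain ⟨l, hl, hlT⟩ := (mem_nhdsLT_iff_exists_Ioo_subset).1 (hlim.eventually_ge_atTop 0)
  obtain ⟨b, hb, hbT⟩ := exists_between (max_lt hl h)
  obtain ⟨hlb, hab⟩ := max_lt_iff.1 hb
  obtain ⟨K, hK⟩ := (isCompact_Icc (a := a) (b := b)).bddBelow_image
    (hf.mono fun x hx => ⟨hx.1, hx.2.trans_lt hbT⟩)
  refine ⟨min K 0, fun t ht => ?_⟩
  rcases lt_or_ge b t with hbt | hbt
  · exact (min_le_right _ _).trans (hlT ⟨hlb.trans hbt, ht.2⟩)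
  · exact (min_le_left _ _).trans (hK ⟨t, ⟨ht.1, hbt⟩, rfl⟩)

theorem eventually_neg_le_of_tendsto_zero {l : Filter ℝ} {w : ℝ → ℝ}
    (hw : Tendsto w l (nhds 0)) : ∀ ε > 0, ∀ᶠ t in l, -ε ≤ w t := fun ε hε =>
  (hw.eventually (lt_mem_nhds (show -ε < 0 by linarith))).mono fun _ h => h.le

theorem hasDerivAt_mul_tanh_mul_sub (κ T t : ℝ) :
    HasDerivAt (fun t => κ * Real.tanh (κ * (T - t)))
      ((κ * Real.tanh (κ * (T - t))) ^ 2 - κ ^ 2) t := by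
  have hlin : HasDerivAt (fun t => κ * (T - t)) (-κ) t := by
    simpa using ((hasDerivAt_id t).const_sub T).const_mul κ
  have hc := (Real.cosh_pos (κ * (T - t))).ne'
  have h := ((hlin.sinh.div hlin.cosh hc).const_mul κ)
  simp only [Real.tanh_eq_sinh_div_cosh]
  refine h.congr_deriv ?_
  field_simp
  ring

theorem mul_tanh_nonneg {κ x : ℝ} (hκ : 0 < κ) (hx : 0 ≤ x) : 0 ≤ κ * Real.tanh (κ * x) := by
  rw [Real.tanh_eq_sinh_div_cosh]
  have := Real.sinh_nonneg_iff.2 (mul_nonneg hκ.le hx)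
  have := Real.cosh_pos (κ * x)
  positivity

theorem tendsto_mul_tanh_mul_sub (κ T : ℝ) :
    Tendsto (fun t => κ * Real.tanh (κ * (T - t))) (nhdsWithin T (Iio T)) (nhds 0) := by
  simpa using (hasDerivAt_mul_tanh_mul_sub κ T T).continuousAt.tendsto.mono_left nhdsWithin_le_nhds

/-- Supersolutions of `dG/dt = G² - κ²` vanishing at `T` lie below `κ tanh (κ (T - t))`. -/
theorem le_mul_tanh_of_sq_sub_sq_le_deriv {s T κ : ℝ} (hκ : 0 < κ) {G G' : ℝ → ℝ}
    (hG : ∀ t ∈ Ico s T, HasDerivWithinAt G (G' t) (Ico s T) t)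
    (hG' : ∀ t ∈ Ico s T, G t ^ 2 - κ ^ 2 ≤ G' t)
    (hnonneg : ∀ t ∈ Ico s T, 0 ≤ G t)
    (hlim : Tendsto G (nhdsWithin T (Iio T)) (nhds 0)) :
    ∀ t ∈ Ico s T, G t ≤ κ * Real.tanh (κ * (T - t)) := by
  intro t ht
  refine sub_nonneg.1 (nonneg_of_deriv_le_mul (K := 0)
    (w := fun t => κ * Real.tanh (κ * (T - t)) - G t)
    (g := fun t => κ * Real.tanh (κ * (T - t)) + G t)
    (fun t ht => (hasDerivAt_mul_tanh_mul_sub κ T t).hasDerivWithinAt.sub (hG t ht)) ?_ ?_ ?_ t ht)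
  · intro t ht _
    linarith [hG' t ht]
  · intro t ht
    exact add_nonneg (mul_tanh_nonneg hκ (sub_nonneg.2 ht.2.le)) (hnonneg t ht)
  · exact eventually_neg_le_of_tendsto_zero (by simpa using (tendsto_mul_tanh_mul_sub κ T).sub hlim)

/-- Positive supersolutions of `dD/dt = D² - κ²` exploding at `T` lie below `κ coth (κ (T - t))`. -/
theorem le_mul_coth_of_sq_sub_sq_le_deriv {s T κ : ℝ} (hκ : 0 < κ) {D D' : ℝ → ℝ}
    (hD : ∀ t ∈ Ico s T, HasDerivWithinAt D (D' t) (Ico s T) t)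
    (hD' : ∀ t ∈ Ico s T, D t ^ 2 - κ ^ 2 ≤ D' t)
    (hpos : ∀ t ∈ Ico s T, 0 < D t)
    (hlim : Tendsto D (nhdsWithin T (Iio T)) atTop) :
    ∀ t ∈ Ico s T, D t ≤ κ * (Real.cosh (κ * (T - t)) / Real.sinh (κ * (T - t))) := by
  intro t ht
  have key := sub_nonneg.1 (nonneg_of_deriv_le_mul (K := 0)
    (w := fun t => κ ^ 2 * (D t)⁻¹ - κ * Real.tanh (κ * (T - t)))
    (g := fun t => κ ^ 2 * (D t)⁻¹ + κ * Real.tanh (κ * (T - t)))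
    (fun t ht => (((hD t ht).inv (hpos t ht).ne').const_mul (κ ^ 2)).sub
      (hasDerivAt_mul_tanh_mul_sub κ T t).hasDerivWithinAt) ?_ ?_ ?_ t ht)
  · have hx : 0 < κ * (T - t) := mul_pos hκ (sub_pos.2 ht.2)
    have hs := Real.sinh_pos_iff.2 hx
    have hc := Real.cosh_pos (κ * (T - t))
    have hDt := hpos t ht
    rw [Real.tanh_eq_sinh_div_cosh] at key
    have h1 : κ * (Real.sinh (κ * (T - t)) * D t) ≤ κ * (κ * Real.cosh (κ * (T - t))) := by
      field_simp at key
      nlinarith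
    have h2 := le_of_mul_le_mul_left h1 hκ
    rw [← mul_div_assoc, le_div_iff₀ hs]
    linarith
  · intro t ht _
    have hDt := hpos t ht
    have h1 : -D' t / D t ^ 2 ≤ κ ^ 2 * (D t)⁻¹ ^ 2 - 1 := by
      rw [div_le_iff₀ (by positivity)]
      have : (κ ^ 2 * (D t)⁻¹ ^ 2 - 1) * D t ^ 2 = κ ^ 2 - D t ^ 2 := by field_simp
      linarith [hD' t ht]
    have h2 := mul_le_mul_of_nonneg_left h1 (sq_nonneg κ)
    linarith
  · intro t ht
    have := (hpos t ht)
    have := mul_tanh_nonneg hκ (sub_nonneg.2 ht.2.le)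
    positivity
  · refine eventually_neg_le_of_tendsto_zero ?_
    simpa using ((tendsto_inv_atTop_zero.comp hlim).const_mul (κ ^ 2)).sub
      (tendsto_mul_tanh_mul_sub κ T)

theorem hasDerivAt_div_exp_sub_one {c a t : ℝ} (hc : 0 < c) (hta : t < a) :
    HasDerivAt (fun t => c / (Real.exp (c * (a - t)) - 1))
      ((c / (Real.exp (c * (a - t)) - 1)) ^ 2 + c * (c / (Real.exp (c * (a - t)) - 1))) t := by
  have hlin : HasDerivAt (fun t => c * (a - t)) (-c) t := by
    simpa using ((hasDerivAt_id t).const_sub a).const_mul c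
  have hne : 0 < Real.exp (c * (a - t)) - 1 :=
    sub_pos.2 (Real.one_lt_exp_iff.2 (mul_pos hc (sub_pos.2 hta)))
  refine ((hasDerivAt_const t c).div (hlin.exp.sub_const 1) hne.ne').congr_deriv ?_
  field_simp
  ring

theorem div_exp_sub_one_pos {c a t : ℝ} (hc : 0 < c) (hta : t < a) :
    0 < c / (Real.exp (c * (a - t)) - 1) :=
  div_pos hc (sub_pos.2 (Real.one_lt_exp_iff.2 (mul_pos hc (sub_pos.2 hta))))

/-- Nonnegative subsolutions of `dD/dt = D² + c D` exploding at `T` lie above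
`c / (exp (c (T - t)) - 1)`. -/
theorem div_exp_sub_one_le_of_deriv_le {s T c : ℝ} (hc : 0 < c) {D D' : ℝ → ℝ}
    (hD : ∀ t ∈ Ico s T, HasDerivWithinAt D (D' t) (Ico s T) t)
    (hD' : ∀ t ∈ Ico s T, D' t ≤ D t ^ 2 + c * D t)
    (hnonneg : ∀ t ∈ Ico s T, 0 ≤ D t)
    (hlim : Tendsto D (nhdsWithin T (Iio T)) atTop) :
    ∀ t ∈ Ico s T, c / (Real.exp (c * (T - t)) - 1) ≤ D t := by
  have shifted : ∀ a > T, ∀ t ∈ Ico s T, c / (Real.exp (c * (a - t)) - 1) ≤ D t := by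
    intro a ha t ht
    refine sub_nonneg.1 (nonneg_of_deriv_le_mul (K := 0)
      (w := fun t => D t - c / (Real.exp (c * (a - t)) - 1))
      (g := fun t => D t + c / (Real.exp (c * (a - t)) - 1) + c)
      (fun t ht => (hD t ht).sub
        (hasDerivAt_div_exp_sub_one hc (ht.2.trans ha)).hasDerivWithinAt) ?_ ?_ ?_ t ht)
    · intro t ht _
      linarith [hD' t ht]
    · intro t ht
      linarith [hnonneg t ht, div_exp_sub_one_pos hc (ht.2.trans ha)]
    · intro ε hε
      have hcont := (hasDerivAt_div_exp_sub_one hc ha).continuousAt.tendsto.mono_left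
        (nhdsWithin_le_nhds (s := Iio T))
      filter_upwards [hlim.eventually_ge_atTop (c / (Real.exp (c * (a - T)) - 1) + 1),
        hcont.eventually (gt_mem_nhds (lt_add_one _))] with x h1 h2
      linarith
  intro t ht
  have hne : Real.exp (c * (T - t)) - 1 ≠ 0 :=
    (sub_pos.2 (Real.one_lt_exp_iff.2 (mul_pos hc (sub_pos.2 ht.2)))).ne'
  have hcont : ContinuousAt (fun a => c / (Real.exp (c * (a - t)) - 1)) T := by
    fun_prop (disch := exact hne)
  refine le_of_tendsto (hcont.tendsto.mono_left (nhdsWithin_le_nhds (s := Ioi T))) ?_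
  filter_upwards [self_mem_nhdsWithin] with a ha using shifted a ha t ht

theorem exp_neg_mul_le_of_deriv_le_mul {s T R : ℝ} {B B' ρ : ℝ → ℝ}
    (hB : ∀ t ∈ Ico s T, HasDerivWithinAt B (B' t) (Ico s T) t)
    (hB' : ∀ t ∈ Ico s T, B' t ≤ ρ t * B t)
    (hρ : ∀ t ∈ Ico s T, 0 ≤ ρ t) (hρR : ∀ t ∈ Ico s T, ρ t ≤ R)
    (hlim : Tendsto B (nhdsWithin T (Iio T)) (nhds 1)) :
    ∀ t ∈ Ico s T, Real.exp (-R * (T - t)) ≤ B t := by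
  intro t ht
  have hexp : ∀ t, HasDerivAt (fun t => Real.exp (-R * (T - t))) (Real.exp (-R * (T - t)) * R) t :=
    fun t => by simpa using (((hasDerivAt_id t).const_sub T).const_mul (-R)).exp
  refine sub_nonneg.1 (nonneg_of_deriv_le_mul (K := 0) (g := ρ)
    (w := fun t => B t - Real.exp (-R * (T - t)))
    (fun t ht => (hB t ht).sub (hexp t).hasDerivWithinAt) ?_ hρ ?_ t ht)
  · intro t ht _
    have := mul_le_mul_of_nonneg_left (hρR t ht) (Real.exp_pos (-R * (T - t))).le
    linarith [hB' t ht]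
  · refine eventually_neg_le_of_tendsto_zero ?_
    simpa using hlim.sub ((hexp T).continuousAt.tendsto.mono_left nhdsWithin_le_nhds)

/-- A priori barrier estimates for the deterministic Riccati system of the
optimal execution problem: with `κ = √(2η⁻¹ max{sup λ, γ sup ρ})`, the
feedback coefficients `D = η⁻¹(A − γB)`, `E = η⁻¹(γC − B + 1)` and `B`
satisfy the two-sided barriers
`η⁻¹γ/(e^{η⁻¹γ(T−t)} − 1) ≤ D ≤ κ coth(κ(T−t))`,
`e^{−(sup ρ)(T−t)} ≤ B ≤ 1`, `0 ≤ E ≤ γ⁻¹κ tanh(κ(T−t))`. -/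
theorem stmt_5 (T η γ : ℝ) (hT : 0 < T) (hη : 0 < η) (hγ : 0 < γ)
    (lam ρ : ℝ → ℝ)
    (hlam_cont : ContinuousOn lam (Icc 0 T))
    (hlam_nonneg : ∀ t ∈ Icc (0 : ℝ) T, 0 ≤ lam t)
    (hρ_cont : ContinuousOn ρ (Icc 0 T))
    (hρ_nonneg : ∀ t ∈ Icc (0 : ℝ) T, 0 ≤ ρ t)
    (A B C : ℝ → ℝ)
    (hA : ∀ t ∈ Ico (0 : ℝ) T, HasDerivWithinAt A
      (-lam t + η⁻¹ * (A t - γ * B t) ^ 2) (Ico 0 T) t)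
    (hB : ∀ t ∈ Ico (0 : ℝ) T, HasDerivWithinAt B
      (ρ t * B t - η⁻¹ * (γ * C t - B t + 1) * (A t - γ * B t)) (Ico 0 T) t)
    (hC : ∀ t ∈ Ico (0 : ℝ) T, HasDerivWithinAt C
      (2 * ρ t * C t + η⁻¹ * (γ * C t - B t + 1) ^ 2) (Ico 0 T) t)
    (hAT : Tendsto A (nhdsWithin T (Iio T)) atTop)
    (hBT : Tendsto B (nhdsWithin T (Iio T)) (nhds 1))
    (hCT : Tendsto C (nhdsWithin T (Iio T)) (nhds 0))
    (κ : ℝ)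
    (hκdef : κ = Real.sqrt (2 * η⁻¹ *
      max (sSup (lam '' Icc 0 T)) (γ * sSup (ρ '' Icc 0 T))))
    (hκpos : 0 < κ) :
    ∀ t ∈ Ico (0 : ℝ) T,
      (η⁻¹ * γ) / (Real.exp (η⁻¹ * γ * (T - t)) - 1) ≤ η⁻¹ * (A t - γ * B t)
      ∧ η⁻¹ * (A t - γ * B t)
          ≤ κ * (Real.cosh (κ * (T - t)) / Real.sinh (κ * (T - t)))
      ∧ Real.exp (-(sSup (ρ '' Icc 0 T)) * (T - t)) ≤ B t
      ∧ B t ≤ 1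
      ∧ 0 ≤ η⁻¹ * (γ * C t - B t + 1)
      ∧ η⁻¹ * (γ * C t - B t + 1) ≤ γ⁻¹ * κ * Real.tanh (κ * (T - t)) := by
  set D : ℝ → ℝ := fun t => η⁻¹ * (A t - γ * B t) with hDdef
  set E : ℝ → ℝ := fun t => η⁻¹ * (γ * C t - B t + 1) with hEdef
  set R := sSup (ρ '' Icc 0 T) with hRdef
  have hηinv : 0 < η⁻¹ := inv_pos.2 hη
  have hηη : η⁻¹ * η = 1 := inv_mul_cancel₀ hη.ne'
  have hI : ∀ t ∈ Ico (0 : ℝ) T, t ∈ Icc (0 : ℝ) T := fun t ht => Ico_subset_Icc_self ht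
  have hρR : ∀ t ∈ Icc (0 : ℝ) T, ρ t ≤ R := fun t ht =>
    le_csSup (isCompact_Icc.bddAbove_image hρ_cont) ⟨t, ht, rfl⟩
  have hlamL : ∀ t ∈ Icc (0 : ℝ) T, lam t ≤ sSup (lam '' Icc 0 T) := fun t ht =>
    le_csSup (isCompact_Icc.bddAbove_image hlam_cont) ⟨t, ht, rfl⟩
  have hκsq : κ ^ 2 = 2 * η⁻¹ * max (sSup (lam '' Icc 0 T)) (γ * R) := by
    rw [hκdef]
    exact Real.sq_sqrt (Real.sqrt_pos.1 (hκdef ▸ hκpos)).le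
  have hlamκ : ∀ t ∈ Ico (0 : ℝ) T, 2 * η⁻¹ * lam t ≤ κ ^ 2 := fun t ht => by
    rw [hκsq]
    have := (hlamL t (hI t ht)).trans (le_max_left _ (γ * R))
    gcongr
  have hρκ : ∀ t ∈ Ico (0 : ℝ) T, 2 * η⁻¹ * (γ * ρ t) ≤ κ ^ 2 := fun t ht => by
    rw [hκsq]
    have := (mul_le_mul_of_nonneg_left (hρR t (hI t ht)) hγ.le).trans
      (le_max_right (sSup (lam '' Icc 0 T)) (γ * R))
    gcongr
  have hC_eq : ∀ t, γ * C t = η * E t + B t - 1 := fun t => by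
    simp only [hEdef]; field_simp; ring
  have hBd : ∀ t ∈ Ico (0 : ℝ) T,
      HasDerivWithinAt B (ρ t * B t - η * (E t * D t)) (Ico 0 T) t := fun t ht =>
    (hB t ht).congr_deriv (by simp only [hDdef, hEdef]; field_simp)
  have hDd : ∀ t ∈ Ico (0 : ℝ) T, HasDerivWithinAt D
      (D t * (D t + γ * E t) - η⁻¹ * (lam t + γ * (ρ t * B t))) (Ico 0 T) t := fun t ht =>
    (((hA t ht).sub ((hB t ht).const_mul γ)).const_mul η⁻¹).congr_deriv (by
      simp only [hDdef, hEdef]; ring)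
  have hEd : ∀ t ∈ Ico (0 : ℝ) T, HasDerivWithinAt E
      (E t * (D t + γ * E t + ρ t) - η⁻¹ * (ρ t * (1 - γ * C t))) (Ico 0 T) t := fun t ht =>
    (((((hC t ht).const_mul γ).sub (hB t ht)).add_const 1).const_mul η⁻¹).congr_deriv (by
      simp only [hDdef, hEdef]; ring)
  have hDT : Tendsto D (nhdsWithin T (Iio T)) atTop := by
    refine Tendsto.const_mul_atTop hηinv ?_
    simpa [sub_eq_add_neg] using hAT.atTop_add (hBT.const_mul γ).neg
  have hET : Tendsto E (nhdsWithin T (Iio T)) (nhds 0) := by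
    simpa using (((hCT.const_mul γ).sub hBT).add_const 1).const_mul η⁻¹
  have hDcont : ContinuousOn D (Ico 0 T) := fun t ht => (hDd t ht).continuousWithinAt
  have hEcont : ContinuousOn E (Ico 0 T) := fun t ht => (hEd t ht).continuousWithinAt
  have hBcont : ContinuousOn B (Ico 0 T) := fun t ht => (hBd t ht).continuousWithinAt
  obtain ⟨K, hK⟩ := exists_lower_bound_of_tendsto_atTop
    (hDcont.add (hEcont.const_smul γ)) (hDT.atTop_add (hET.const_smul γ))
  simp only [Pi.add_apply, Pi.smul_apply, smul_eq_mul] at hK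
  have hCle : ∀ t ∈ Ico (0 : ℝ) T, C t ≤ 0 := by
    intro t ht
    refine neg_nonneg.1 (nonneg_of_deriv_le_mul (K := 0) (w := fun t => -C t)
      (g := fun t => 2 * ρ t) (fun t ht => (hC t ht).neg) ?_ ?_ ?_ t ht)
    · intro t ht _
      have : 0 ≤ η⁻¹ * (γ * C t - B t + 1) ^ 2 := by positivity
      linarith
    · intro t ht
      linarith [hρ_nonneg t (hI t ht)]
    · exact eventually_neg_le_of_tendsto_zero (by simpa using hCT.neg)
  have hEnonneg : ∀ t ∈ Ico (0 : ℝ) T, 0 ≤ E t := by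
    refine nonneg_of_deriv_le_mul (K := K) (g := fun t => D t + γ * E t + ρ t) hEd ?_ ?_
      (eventually_neg_le_of_tendsto_zero hET)
    · intro t ht _
      have h1 : 0 ≤ 1 - γ * C t := by nlinarith [hCle t ht]
      have h2 : 0 ≤ η⁻¹ * (ρ t * (1 - γ * C t)) :=
        mul_nonneg hηinv.le (mul_nonneg (hρ_nonneg t (hI t ht)) h1)
      linarith
    · intro t ht
      linarith [hK t ht, hρ_nonneg t (hI t ht)]
  have hBle : ∀ t ∈ Ico (0 : ℝ) T, B t ≤ 1 := fun t ht => by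
    nlinarith [hC_eq t, hCle t ht, mul_nonneg hη.le (hEnonneg t ht)]
  have hDnonneg_of : ∀ s ∈ Ico (0 : ℝ) T, (∀ t ∈ Ico s T, 0 ≤ B t) →
      ∀ t ∈ Ico s T, 0 ≤ D t := by
    intro s hs hBs
    have hsub : Ico s T ⊆ Ico 0 T := Ico_subset_Ico_left hs.1
    refine nonneg_of_deriv_le_mul (K := K) (g := fun t => D t + γ * E t)
      (fun t ht => (hDd t (hsub ht)).mono hsub) ?_ (fun t ht => hK t (hsub ht)) ?_
    · intro t ht _
      have h1 := hlam_nonneg t (hI t (hsub ht))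
      have h2 := mul_nonneg (hρ_nonneg t (hI t (hsub ht))) (hBs t ht)
      have h3 : 0 ≤ η⁻¹ * (lam t + γ * (ρ t * B t)) := by positivity
      linarith
    · exact fun ε hε => (hDT.eventually_ge_atTop 0).mono fun t ht => by linarith
  have hBlower_of : ∀ s ∈ Ico (0 : ℝ) T, (∀ t ∈ Ico s T, 0 ≤ B t) →
      ∀ t ∈ Ico s T, Real.exp (-R * (T - t)) ≤ B t := by
    intro s hs hBs
    have hsub : Ico s T ⊆ Ico 0 T := Ico_subset_Ico_left hs.1
    refine exp_neg_mul_le_of_deriv_le_mul (fun t ht => (hBd t (hsub ht)).mono hsub) ?_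
      (fun t ht => hρ_nonneg t (hI t (hsub ht))) (fun t ht => hρR t (hI t (hsub ht))) hBT
    intro t ht
    have := mul_nonneg hη.le (mul_nonneg (hEnonneg t (hsub ht)) (hDnonneg_of s hs hBs t ht))
    linarith
  have hBpos : ∀ t ∈ Ico (0 : ℝ) T, 0 < B t := by
    intro t ht
    by_contra! h
    obtain ⟨s, hs, hBs, hafter⟩ :=
      exists_last_zero hBcont (hBT.eventually (lt_mem_nhds one_pos)) ht h
    have := hBlower_of s hs hafter s ⟨le_rfl, hs.2⟩
    linarith [Real.exp_pos (-R * (T - s))]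
  have h0 : (0 : ℝ) ∈ Ico 0 T := ⟨le_rfl, hT⟩
  have hDnonneg := hDnonneg_of 0 h0 fun t ht => (hBpos t ht).le
  have hDlower := div_exp_sub_one_le_of_deriv_le (mul_pos hηinv hγ) hDd (fun t ht => by
    have h1 := hlam_nonneg t (hI t ht)
    have h2 := mul_nonneg (hρ_nonneg t (hI t ht)) (hBpos t ht).le
    have h3 : 0 ≤ η⁻¹ * (lam t + γ * (ρ t * B t)) := by positivity
    have h4 : E t ≤ η⁻¹ := by
      have : γ * C t - B t + 1 ≤ 1 := by nlinarith [hCle t ht, hBpos t ht]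
      simpa using mul_le_mul_of_nonneg_left this hηinv.le
    have h5 := mul_le_mul_of_nonneg_left h4 (mul_nonneg hγ.le (hDnonneg t ht))
    linarith) hDnonneg hDT
  have hDpos : ∀ t ∈ Ico (0 : ℝ) T, 0 < D t := fun t ht =>
    (div_exp_sub_one_pos (mul_pos hηinv hγ) ht.2).trans_le (hDlower t ht)
  have hDupper := le_mul_coth_of_sq_sub_sq_le_deriv hκpos hDd (fun t ht => by
    have h1 := mul_nonneg hγ.le (mul_nonneg (hEnonneg t ht) (hDnonneg t ht))
    have h2 : η⁻¹ * (γ * (ρ t * B t)) ≤ η⁻¹ * (γ * ρ t) := by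
      have := mul_le_of_le_one_right (hρ_nonneg t (hI t ht)) (hBle t ht)
      gcongr
    linarith [hlamκ t ht, hρκ t ht]) hDpos hDT
  have hEupper := le_mul_tanh_of_sq_sub_sq_le_deriv hκpos
    (fun t ht => (hEd t ht).const_mul γ) (fun t ht => by
      have h1 := mul_nonneg hγ.le (mul_nonneg (hEnonneg t ht) (hDnonneg t ht))
      have hρt := hρ_nonneg t (hI t ht)
      have h2 : 0 ≤ η⁻¹ * (γ * (ρ t * B t)) := by
        have := hBpos t ht
        positivity
      have h3 : 0 ≤ γ * (ρ t * E t) := by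
        have := hEnonneg t ht
        positivity
      have h4 : γ * (η⁻¹ * (ρ t * (1 - γ * C t))) =
          2 * η⁻¹ * (γ * ρ t) - η⁻¹ * (γ * (ρ t * B t)) - γ * (ρ t * E t) := by
        rw [hC_eq]
        linear_combination (-γ * ρ t * E t) * hηη
      linarith [hρκ t ht])
    (fun t ht => mul_nonneg hγ.le (hEnonneg t ht)) (by simpa using hET.const_mul γ)
  intro t ht
  refine ⟨hDlower t ht, hDupper t ht, hBlower_of 0 h0 (fun t ht => (hBpos t ht).le) t ht,
    hBle t ht, hEnonneg t ht, ?_⟩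
  rw [mul_assoc]
  exact (le_inv_mul_iff₀ hγ).2 (hEupper t ht)
end

section
/- Let T > 0, η > 0, γ > 0, and let λ, ρ : [0,T] → [0,∞) be continuous. Let A, B, C : [0,T) → ℝ be continuously differentiable and satisfy, for all t ∈ [0,T), A'(t) = −λ(t) + η⁻¹(A(t) − γB(t))², B'(t) = ρ(t)B(t) − η⁻¹(γC(t) − B(t) + 1)(A(t) − γB(t)), C'(t) = 2ρ(t)C(t) + η⁻¹(γC(t) − B(t) + 1)², together with A(t) → +∞, B(t) → 1 and C(t) → 0 as t → T. Then there exist a constant M > 0 and t₀ ∈ [0,T) such that for all t ∈ [t₀,T): |(T−t)·A(t) − η| ≤ M·(T−t), |B(t) − 1| ≤ M·(T−t), and |C(t)| ≤ M·(T−t)³. -/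
open Set Filter

open Asymptotics Topology in
/-- A function vanishing at `T` whose derivative is `O((T - t) ^ n)` is `O((T - t) ^ (n + 1))`. -/
theorem isBigO_sub_pow_succ_of_hasDerivAt {T : ℝ} {n : ℕ} {f f' : ℝ → ℝ}
    (hf : ∀ᶠ t in 𝓝[<] T, HasDerivAt f (f' t) t)
    (hf' : f' =O[𝓝[<] T] fun t => (T - t) ^ n)
    (h0 : Tendsto f (𝓝[<] T) (𝓝 0)) :
    f =O[𝓝[<] T] fun t => (T - t) ^ (n + 1) := by
  obtain ⟨K, hK0, hK⟩ := hf'.exists_nonneg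
  obtain ⟨a, haT, ha⟩ := mem_nhdsLT_iff_exists_Ioo_subset.1 (hf.and hK.bound)
  refine IsBigO.of_bound K ?_
  filter_upwards [Ioo_mem_nhdsLT haT] with t ht
  have hu : 0 < T - t := sub_pos.2 ht.2
  have hbound : ∀ᶠ s in 𝓝[<] T, ‖f s - f t‖ ≤ K * (T - t) ^ n * (T - t) := by
    filter_upwards [Ioo_mem_nhdsLT ht.2] with s hs
    have key := (convex_Icc t s).norm_image_sub_le_of_norm_hasDerivWithin_le
      (f := f) (f' := f') (C := K * (T - t) ^ n)
      (fun x hx => (ha ⟨ht.1.trans_le hx.1, hx.2.trans_lt hs.2⟩).1.hasDerivWithinAt)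
      (fun x hx => by
        have hx' := (ha ⟨ht.1.trans_le hx.1, hx.2.trans_lt hs.2⟩).2
        have hxT : 0 ≤ T - x := sub_nonneg.2 (hx.2.trans hs.2.le)
        rw [Real.norm_of_nonneg (pow_nonneg hxT n)] at hx'
        refine hx'.trans ?_
        gcongr
        exact hx.1)
      (left_mem_Icc.2 hs.1.le) (right_mem_Icc.2 hs.1.le)
    refine key.trans ?_
    rw [Real.norm_of_nonneg (sub_nonneg.2 hs.1.le)]
    have := hs.2
    gcongr
  have hlim := le_of_tendsto ((h0.sub_const (f t)).norm) hbound
  rw [Real.norm_of_nonneg (pow_nonneg hu.le (n + 1)), pow_succ, ← mul_assoc]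
  simpa using hlim

open Asymptotics Topology in
/-- Asymptotic behavior at the terminal time for the deterministic Riccati
system of the optimal execution problem:
`(T−t)A(t) = η + O(T−t)`, `B(t) = 1 + O(T−t)`, `C(t) = O((T−t)³)`. -/
theorem stmt_6 (T η γ : ℝ) (hT : 0 < T) (hη : 0 < η) (hγ : 0 < γ)
    (lam ρ : ℝ → ℝ)
    (hlam_cont : ContinuousOn lam (Icc 0 T))
    (hlam_nonneg : ∀ t ∈ Icc (0 : ℝ) T, 0 ≤ lam t)
    (hρ_cont : ContinuousOn ρ (Icc 0 T))
    (hρ_nonneg : ∀ t ∈ Icc (0 : ℝ) T, 0 ≤ ρ t)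
    (A B C : ℝ → ℝ)
    (hA : ∀ t ∈ Ico (0 : ℝ) T, HasDerivWithinAt A
      (-lam t + η⁻¹ * (A t - γ * B t) ^ 2) (Ico 0 T) t)
    (hB : ∀ t ∈ Ico (0 : ℝ) T, HasDerivWithinAt B
      (ρ t * B t - η⁻¹ * (γ * C t - B t + 1) * (A t - γ * B t)) (Ico 0 T) t)
    (hC : ∀ t ∈ Ico (0 : ℝ) T, HasDerivWithinAt C
      (2 * ρ t * C t + η⁻¹ * (γ * C t - B t + 1) ^ 2) (Ico 0 T) t)
    (hAT : Tendsto A (nhdsWithin T (Iio T)) atTop)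
    (hBT : Tendsto B (nhdsWithin T (Iio T)) (nhds 1))
    (hCT : Tendsto C (nhdsWithin T (Iio T)) (nhds 0)) :
    ∃ M > 0, ∃ t₀ ∈ Ico (0 : ℝ) T, ∀ t ∈ Ico t₀ T,
      |(T - t) * A t - η| ≤ M * (T - t)
      ∧ |B t - 1| ≤ M * (T - t)
      ∧ |C t| ≤ M * (T - t) ^ 3 := by
  have hE0 : Tendsto (fun t => γ * C t - B t + 1) (𝓝[<] T) (𝓝 0) := by
    simpa using ((hCT.const_mul γ).sub hBT).add_const 1
  have hPT : Tendsto (fun t => A t - γ * B t) (𝓝[<] T) atTop := by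
    simpa [sub_eq_add_neg] using hAT.atTop_add (hBT.const_mul γ).neg
  have hmem : ∀ᶠ t in 𝓝[<] T, t ∈ Ioo 0 T := Ioo_mem_nhdsLT hT
  have hIco : ∀ t ∈ Ioo 0 T, Ico 0 T ∈ 𝓝 t := fun t ht => Ico_mem_nhds ht.1 ht.2
  have hnhds : 𝓝[<] T ≤ 𝓝[Icc 0 T] T :=
    nhdsWithin_le_of_mem (mem_of_superset hmem Ioo_subset_Icc_self)
  have hlam1 : lam =O[𝓝[<] T] fun _ => (1 : ℝ) :=
    ((hlam_cont T (right_mem_Icc.2 hT.le)).mono_left hnhds).isBigO_one ℝ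
  have hρ1 : ρ =O[𝓝[<] T] fun _ => (1 : ℝ) :=
    ((hρ_cont T (right_mem_Icc.2 hT.le)).mono_left hnhds).isBigO_one ℝ
  have hB1 : B =O[𝓝[<] T] fun _ => (1 : ℝ) := hBT.isBigO_one ℝ
  have hC1 : C =O[𝓝[<] T] fun _ => (1 : ℝ) := hCT.isBigO_one ℝ
  have hE1 := hE0.isBigO_one ℝ
  have hQ0 := hPT.inv_tendsto_atTop
  have hQ1 := hQ0.isBigO_one ℝ
  have hP0 : ∀ᶠ t in 𝓝[<] T, 0 < A t - γ * B t := hPT.eventually_gt_atTop 0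
  set P : ℝ → ℝ := fun t => A t - γ * B t with hP
  set E : ℝ → ℝ := fun t => γ * C t - B t + 1 with hE
  have hone : ∀ c : ℝ, (fun _ : ℝ => c) =O[𝓝[<] T] fun _ => (1 : ℝ) := fun c =>
    isBigO_const_const c one_ne_zero _
  have hu : Tendsto (fun t => T - t) (𝓝[<] T) (𝓝 0) := by
    have : Tendsto (fun t => T - t) (𝓝 T) (𝓝 (T - T)) := tendsto_const_nhds.sub tendsto_id
    simpa using this.mono_left nhdsWithin_le_nhds
  have hQ' : ∀ᶠ t in 𝓝[<] T, HasDerivAt P⁻¹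
      (-η⁻¹ + ((lam t + γ * (ρ t * B t)) * P⁻¹ t - γ * η⁻¹ * E t) * P⁻¹ t) t := by
    filter_upwards [hmem, hP0] with t ht hPt
    have h1 := (hA t (Ioo_subset_Ico_self ht)).hasDerivAt (hIco t ht)
    have h2 := (hB t (Ioo_subset_Ico_self ht)).hasDerivAt (hIco t ht)
    have hPt' : A t - γ * B t ≠ 0 := hPt.ne'
    refine ((h1.sub (h2.const_mul γ)).inv hPt').congr_deriv ?_
    simp only [hP, hE, Pi.inv_apply, Pi.sub_apply]
    field_simp
    ring
  have hlrB : (fun t => lam t + γ * (ρ t * B t)) =O[𝓝[<] T] fun _ => (1 : ℝ) :=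
    hlam1.add (by simpa using ((hone γ).mul (hρ1.mul hB1)))
  have hcoef : (fun t => (lam t + γ * (ρ t * B t)) * P⁻¹ t - γ * η⁻¹ * E t) =O[𝓝[<] T]
      fun _ => (1 : ℝ) :=
    (by simpa using hlrB.mul hQ1 :
      (fun t => (lam t + γ * (ρ t * B t)) * P⁻¹ t) =O[𝓝[<] T] fun _ => (1 : ℝ)).sub
      (by simpa using (hone (γ * η⁻¹)).mul hE1)
  have hQ : P⁻¹ =O[𝓝[<] T] fun t => (T - t) := by
    have := isBigO_sub_pow_succ_of_hasDerivAt (n := 0) hQ'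
      (by simpa using (hone (-η⁻¹)).add (by simpa using hcoef.mul hQ1)) hQ0
    simpa using this
  -- The deviation of `P⁻¹` from its linear profile.
  have hR' : ∀ᶠ t in 𝓝[<] T, HasDerivAt (fun t => P⁻¹ t - η⁻¹ * (T - t))
      (((lam t + γ * (ρ t * B t)) * P⁻¹ t - γ * η⁻¹ * E t) * P⁻¹ t) t := by
    filter_upwards [hQ'] with t ht
    refine (ht.sub (((hasDerivAt_id t).const_sub T).const_mul η⁻¹)).congr_deriv ?_
    ring
  have hR0 : Tendsto (fun t => P⁻¹ t - η⁻¹ * (T - t)) (𝓝[<] T) (𝓝 0) := by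
    simpa using hQ0.sub (hu.const_mul η⁻¹)
  have hR2 : (fun t => P⁻¹ t - η⁻¹ * (T - t)) =O[𝓝[<] T] fun t => (T - t) ^ 2 :=
    isBigO_sub_pow_succ_of_hasDerivAt (n := 1) hR' (by simpa using hcoef.mul hQ) hR0
  have huQ : (fun t => T - t) =O[𝓝[<] T] P⁻¹ := by
    have hsmall : (fun t => (T - t) ^ 2) =o[𝓝[<] T] fun t => T - t := by
      have := ((isLittleO_one_iff ℝ).2 hu).mul_isBigO (isBigO_refl (fun t => T - t) (𝓝[<] T))
      simpa [sq] using this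
    have hequiv : P⁻¹ ~[𝓝[<] T] fun t => η⁻¹ * (T - t) :=
      (hR2.trans_isLittleO hsmall).trans_isBigO
        (isBigO_self_const_mul (inv_ne_zero hη.ne') _ _)
    exact (isBigO_self_const_mul (inv_ne_zero hη.ne') _ _).trans hequiv.isBigO_symm
  have hPu : P =O[𝓝[<] T] fun t => (T - t)⁻¹ := by
    have := huQ.inv_rev (by
      filter_upwards [hmem] with t ht h
      exact absurd h (sub_pos.2 ht.2).ne')
    simpa using this
  have hcancel : ∀ {f : ℝ → ℝ} (n : ℕ), (f =O[𝓝[<] T] fun t => (T - t) ^ (n + 1)) →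
      (fun t => f t * P t) =O[𝓝[<] T] fun t => (T - t) ^ n := by
    intro f n hf
    refine (hf.mul hPu).congr' EventuallyEq.rfl ?_
    filter_upwards [hmem] with t ht
    rw [pow_succ, mul_assoc, mul_inv_cancel₀ (sub_pos.2 ht.2).ne', mul_one]
  have hEQ' : ∀ᶠ t in 𝓝[<] T, HasDerivAt (fun t => E t * P⁻¹ t)
      ((γ * (2 * (ρ t * C t)) - ρ t * B t + E t * ((lam t + γ * (ρ t * B t)) * P⁻¹ t))
        * P⁻¹ t) t := by
    filter_upwards [hmem, hP0, hQ'] with t ht hPt hQt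
    have h2 := (hB t (Ioo_subset_Ico_self ht)).hasDerivAt (hIco t ht)
    have h3 := (hC t (Ioo_subset_Ico_self ht)).hasDerivAt (hIco t ht)
    have hPt' : A t - γ * B t ≠ 0 := hPt.ne'
    refine ((((h3.const_mul γ).sub h2).add_const 1).mul hQt).congr_deriv ?_
    simp only [hP, hE, Pi.inv_apply, Pi.sub_apply]
    field_simp
    ring
  have hEQ : (fun t => E t * P⁻¹ t) =O[𝓝[<] T] fun t => (T - t) ^ 2 := by
    refine isBigO_sub_pow_succ_of_hasDerivAt (n := 1) hEQ' ?_ (by simpa using hE0.mul hQ0)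
    have hρC : (fun t => γ * (2 * (ρ t * C t))) =O[𝓝[<] T] fun _ => (1 : ℝ) := by
      simpa using (hone γ).mul ((hone 2).mul (hρ1.mul hC1))
    have hρB : (fun t => ρ t * B t) =O[𝓝[<] T] fun _ => (1 : ℝ) := by simpa using hρ1.mul hB1
    have hlast : (fun t => E t * ((lam t + γ * (ρ t * B t)) * P⁻¹ t)) =O[𝓝[<] T]
        fun _ => (1 : ℝ) := by simpa using hE1.mul (hlrB.mul hQ1)
    simpa using ((hρC.sub hρB).add hlast).mul hQ
  have hEu : E =O[𝓝[<] T] fun t => (T - t) ^ 1 := by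
    refine (hcancel 1 hEQ).congr' ?_ EventuallyEq.rfl
    filter_upwards [hP0] with t ht
    exact inv_mul_cancel_right₀ (ne_of_gt ht : P t ≠ 0) (E t)
  have hBu : (fun t => B t - 1) =O[𝓝[<] T] fun t => (T - t) ^ 1 := by
    refine isBigO_sub_pow_succ_of_hasDerivAt (n := 0)
      (f' := fun t => ρ t * B t - η⁻¹ * (E t * P t)) ?_ ?_ (by simpa using hBT.sub_const 1)
    · filter_upwards [hmem] with t ht
      refine (((hB t (Ioo_subset_Ico_self ht)).hasDerivAt (hIco t ht)).sub_const 1).congr_deriv ?_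
      simp only [hP, hE]
      ring
    · refine IsBigO.sub (by simpa using hρ1.mul hB1) ?_
      exact (hcancel 0 hEu).const_mul_left _
  have hE2 : (fun t => η⁻¹ * E t ^ 2) =O[𝓝[<] T] fun t => (T - t) ^ 2 := by
    simpa using (hEu.pow 2).const_mul_left η⁻¹
  have hpow : ∀ n ≤ 2, (fun t => (T - t) ^ 2) =O[𝓝[<] T] fun t => (T - t) ^ n := by
    intro n hn
    have := (isBigO_refl (fun t => (T - t) ^ n) (𝓝[<] T)).mul ((hu.pow (2 - n)).isBigO_one ℝ)
    simpa [← pow_add, Nat.add_sub_cancel' hn] using this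
  have hCstep : ∀ n ≤ 2, (C =O[𝓝[<] T] fun t => (T - t) ^ n) →
      C =O[𝓝[<] T] fun t => (T - t) ^ (n + 1) := by
    intro n hn h
    refine isBigO_sub_pow_succ_of_hasDerivAt
      (f' := fun t => 2 * ρ t * C t + η⁻¹ * E t ^ 2) ?_ ?_ hCT
    · filter_upwards [hmem] with t ht
      exact (hC t (Ioo_subset_Ico_self ht)).hasDerivAt (hIco t ht)
    · refine IsBigO.add ?_ (hE2.trans (hpow n hn))
      simpa using (hρ1.const_mul_left 2).mul h
  have hC3 : C =O[𝓝[<] T] fun t => (T - t) ^ 3 :=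
    hCstep 2 le_rfl (hCstep 1 one_le_two (hCstep 0 zero_le_two (by simpa using hC1)))
  have hAu : (fun t => (T - t) * A t - η) =O[𝓝[<] T] fun t => (T - t) ^ 1 := by
    have hBlin := ((isBigO_refl (fun t => (T - t) ^ 1) (𝓝[<] T)).mul hB1).const_mul_left γ
    simp only [mul_one] at hBlin
    refine (((hcancel 1 hR2).const_mul_left (-η)).add hBlin).congr' ?_ EventuallyEq.rfl
    filter_upwards [hP0] with t ht
    have hPt' : A t - γ * B t ≠ 0 := ne_of_gt ht
    simp only [hP, Pi.inv_apply]
    field_simp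
    ring
  obtain ⟨a, ha⟩ := hAu.bound
  obtain ⟨b, hb⟩ := hBu.bound
  obtain ⟨c, hc⟩ := hC3.bound
  obtain ⟨s, hsT, hs⟩ := mem_nhdsLT_iff_exists_Ioo_subset.1 (hmem.and (ha.and (hb.and hc)))
  obtain ⟨t₀, hst, ht₀⟩ := exists_between (mem_Iio.1 hsT)
  refine ⟨max (max |a| |b|) |c| + 1, by positivity, t₀, ?_, fun t ht => ?_⟩
  · exact Ioo_subset_Ico_self (hs ⟨hst, ht₀⟩).1
  obtain ⟨-, h1, h2, h3⟩ := hs ⟨hst.trans_le ht.1, ht.2⟩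
  have hut : 0 < T - t := sub_pos.2 ht.2
  simp only [Real.norm_eq_abs, abs_pow, abs_of_pos hut, pow_one] at h1 h2 h3
  have le_M : ∀ x, |x| ≤ max (max |a| |b|) |c| → x ≤ max (max |a| |b|) |c| + 1 := fun x hx => by
    linarith [le_abs_self x]
  refine ⟨h1.trans ?_, h2.trans ?_, h3.trans ?_⟩ <;> gcongr <;> apply le_M <;> simp
end

section
/- Let T > 0, η > 0, γ ≥ 0, and let λ, ρ : [0,T] → ℝ be bounded functions. Define f : [0,T) × ℝ³ → ℝ³ by f(t,(h,g,p)) = ( (T−t)²λ(t) − η⁻¹(h/(T−t) − γ(T−t+g))² + 2γ(T−t+g) , −ρ(t)(T−t+g) + η⁻¹(γp − g/(T−t))(h/(T−t) − γ(T−t+g)) + γp , −2ρ(t)p − η⁻¹(γp − g/(T−t))² ). Then for every R > 0 there exists L > 0 such that for all t ∈ [0,T) and all y, y' ∈ ℝ³ with |y| ≤ R·(T−t)² and |y'| ≤ R·(T−t)², one has |f(t,y) − f(t,y')| ≤ L·|y − y'|. -/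
open Set

/-- If `a`, `b'` are of size `s * K` and `a`, `b` vary by at most `E / s`, then the product `a * b`
varies by at most `2 * K * E`: the singular factor `1 / s` cancels. -/
lemma abs_mul_sub_mul_le_of_scaled {s K E a b a' b' : ℝ} (hs : 0 < s)
    (ha : |a| ≤ s * K) (hb' : |b'| ≤ s * K) (haa : |a - a'| ≤ E / s) (hbb : |b - b'| ≤ E / s) :
    |a * b - a' * b'| ≤ 2 * K * E := by
  have hsK : 0 ≤ s * K := (abs_nonneg a).trans ha
  calc |a * b - a' * b'| = |a * (b - b') + (a - a') * b'| := by ring_nf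
    _ ≤ |a| * |b - b'| + |a - a'| * |b'| := by
        rw [← abs_mul, ← abs_mul]; exact abs_add_le _ _
    _ ≤ s * K * (E / s) + E / s * (s * K) := by
        have hE : 0 ≤ E / s := (abs_nonneg _).trans haa
        gcongr
    _ = 2 * K * E := by field_simp; ring

/-- Size of the first singular factor on the parabolic neighborhood. -/
lemma abs_div_sub_mul_add_le {s T R γ h g : ℝ} (hs : 0 < s) (hsT : s ≤ T) (hR : 0 ≤ R)
    (hγ : 0 ≤ γ) (hh : |h| ≤ R * s ^ 2) (hg : |g| ≤ R * s ^ 2) :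
    |h / s - γ * (s + g)| ≤ s * (R + γ + γ * R * T) := by
  have hhs : |h / s| ≤ R * s := by
    rw [abs_div, abs_of_pos hs, div_le_iff₀ hs]; linarith
  have hγg : |γ * g| ≤ γ * (R * s * T) := by
    rw [abs_mul, abs_of_nonneg hγ]
    gcongr
    nlinarith [mul_le_mul_of_nonneg_left hsT (mul_nonneg hR hs.le)]
  rw [abs_le] at *
  constructor <;> nlinarith [mul_nonneg hγ hs.le]

/-- Size of the second singular factor on the parabolic neighborhood. -/
lemma abs_mul_sub_div_le {s T R γ g p : ℝ} (hs : 0 < s) (hsT : s ≤ T) (hR : 0 ≤ R)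
    (hγ : 0 ≤ γ) (hg : |g| ≤ R * s ^ 2) (hp : |p| ≤ R * s ^ 2) :
    |γ * p - g / s| ≤ s * (R + γ + γ * R * T) := by
  have hgs : |g / s| ≤ R * s := by
    rw [abs_div, abs_of_pos hs, div_le_iff₀ hs]; linarith
  have hγp : |γ * p| ≤ γ * (R * s * T) := by
    rw [abs_mul, abs_of_nonneg hγ]
    gcongr
    nlinarith [mul_le_mul_of_nonneg_left hsT (mul_nonneg hR hs.le)]
  rw [abs_le] at *
  constructor <;> nlinarith [mul_nonneg hγ hs.le]

/-- A linear form with coefficients `1 / s` and `γ` has norm at most `(1 + γ * T) / s`. -/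
lemma abs_div_sub_mul_le {s T γ d a b : ℝ} (hs : 0 < s) (hsT : s ≤ T) (hγ : 0 ≤ γ)
    (ha : |a| ≤ d) (hb : |b| ≤ d) :
    |a / s - γ * b| ≤ (1 + γ * T) * d / s := by
  have hd : 0 ≤ d := (abs_nonneg a).trans ha
  calc |a / s - γ * b| ≤ |a / s| + |γ * b| := abs_sub _ _
    _ = |a| / s + γ * |b| := by rw [abs_div, abs_mul, abs_of_pos hs, abs_of_nonneg hγ]
    _ ≤ d / s + γ * d := by gcongr
    _ = (1 + γ * s) * d / s := by field_simp
    _ ≤ (1 + γ * T) * d / s := by gcongr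

/-- The driver of the transformed Riccati system (obtained via the asymptotic
ansatz `A = η/(T−t) + H/(T−t)²`, `B = 1 + G/(T−t)`, `C = P`) is Lipschitz,
uniformly in `t ∈ [0,T)`, on the parabolic neighborhoods `{|y| ≤ R(T−t)²}`. -/
theorem stmt_9 (T η γ : ℝ) (hT : 0 < T) (hη : 0 < η) (hγ : 0 ≤ γ)
    (lam ρ : ℝ → ℝ)
    (hlam_bdd : ∃ M : ℝ, ∀ t ∈ Icc (0 : ℝ) T, |lam t| ≤ M)
    (hρ_bdd : ∃ M : ℝ, ∀ t ∈ Icc (0 : ℝ) T, |ρ t| ≤ M) :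
    let f : ℝ → (Fin 3 → ℝ) → (Fin 3 → ℝ) := fun t y =>
      ![(T - t) ^ 2 * lam t
          - η⁻¹ * (y 0 / (T - t) - γ * (T - t + y 1)) ^ 2
          + 2 * γ * (T - t + y 1),
        -(ρ t * (T - t + y 1))
          + η⁻¹ * (γ * y 2 - y 1 / (T - t))
            * (y 0 / (T - t) - γ * (T - t + y 1))
          + γ * y 2,
        -(2 * ρ t * y 2) - η⁻¹ * (γ * y 2 - y 1 / (T - t)) ^ 2]
    ∀ R > 0, ∃ L > 0, ∀ t ∈ Ico (0 : ℝ) T, ∀ y y' : Fin 3 → ℝ,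
      ‖y‖ ≤ R * (T - t) ^ 2 → ‖y'‖ ≤ R * (T - t) ^ 2 →
        ‖f t y - f t y'‖ ≤ L * ‖y - y'‖ := by
  intro f R hR
  obtain ⟨M, hM⟩ := hρ_bdd
  have hM0 : 0 ≤ M := (abs_nonneg _).trans (hM 0 ⟨le_rfl, hT.le⟩)
  have hηi : 0 < η⁻¹ := inv_pos.mpr hη
  set K := R + γ + γ * R * T
  set D := 1 + γ * T
  have hK0 : 0 < K := by positivity
  have hD0 : 0 < D := by positivity
  refine ⟨η⁻¹ * (2 * K * D) + 2 * M + 2 * γ, by positivity, ?_⟩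
  intro t ht y y' hy hy'
  have hs : 0 < T - t := sub_pos.mpr ht.2
  have hsT : T - t ≤ T := by linarith [ht.1]
  have hρ : |ρ t| ≤ M := hM t ⟨ht.1, ht.2.le⟩
  have hyi : ∀ i, |y i| ≤ R * (T - t) ^ 2 := fun i => (norm_le_pi_norm y i).trans hy
  have hyi' : ∀ i, |y' i| ≤ R * (T - t) ^ 2 := fun i => (norm_le_pi_norm y' i).trans hy'
  have hd : ∀ i, |y i - y' i| ≤ ‖y - y'‖ := fun i => norm_le_pi_norm (y - y') i
  have hd0 : 0 ≤ ‖y - y'‖ := norm_nonneg _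
  have hu := abs_div_sub_mul_add_le hs hsT hR.le hγ (hyi 0) (hyi 1)
  have hu' := abs_div_sub_mul_add_le hs hsT hR.le hγ (hyi' 0) (hyi' 1)
  have hv := abs_mul_sub_div_le hs hsT hR.le hγ (hyi 1) (hyi 2)
  have hv' := abs_mul_sub_div_le hs hsT hR.le hγ (hyi' 1) (hyi' 2)
  have huu : |(y 0 / (T - t) - γ * (T - t + y 1)) - (y' 0 / (T - t) - γ * (T - t + y' 1))|
      ≤ D * ‖y - y'‖ / (T - t) := by
    convert abs_div_sub_mul_le hs hsT hγ (hd 0) (hd 1) using 2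
    ring
  have hvv : |(γ * y 2 - y 1 / (T - t)) - (γ * y' 2 - y' 1 / (T - t))|
      ≤ D * ‖y - y'‖ / (T - t) := by
    rw [abs_sub_comm]
    convert abs_div_sub_mul_le hs hsT hγ (hd 1) (hd 2) using 2
    ring
  have hUU := abs_mul_sub_mul_le_of_scaled hs hu hu' huu huu
  have hVU := abs_mul_sub_mul_le_of_scaled hs hv hu' hvv huu
  have hVV := abs_mul_sub_mul_le_of_scaled hs hv hv' hvv hvv
  have hscale : ∀ {c C x e : ℝ}, |c| ≤ C → |x| ≤ e → |c * x| ≤ C * e := fun {c C x e} hc hx => by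
    rw [abs_mul]
    exact mul_le_mul hc hx (abs_nonneg _) ((abs_nonneg _).trans hc)
  have hηabs : |η⁻¹| ≤ η⁻¹ := (abs_of_pos hηi).le
  have hγabs : |γ| ≤ γ := (abs_of_nonneg hγ).le
  have hMd : 0 ≤ M * ‖y - y'‖ := by positivity
  have hγd : 0 ≤ γ * ‖y - y'‖ := by positivity
  refine (pi_norm_le_iff_of_nonneg (by positivity)).mpr fun i => ?_
  rw [Real.norm_eq_abs]
  fin_cases i
  · have h₁ := abs_le.mp (hscale hηabs hUU)
    have h₂ := abs_le.mp (hscale hγabs (hd 1))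
    simp only [f, Fin.zero_eta, Pi.sub_apply, Matrix.cons_val]
    rw [abs_le]
    constructor <;> linarith
  · have h₁ := abs_le.mp (hscale hηabs hVU)
    have h₂ := abs_le.mp (hscale hγabs (hd 2))
    have h₃ := abs_le.mp (hscale hρ (hd 1))
    simp only [f, Fin.mk_one, Pi.sub_apply, Matrix.cons_val]
    rw [abs_le]
    constructor <;> linarith
  · have h₁ := abs_le.mp (hscale hηabs hVV)
    have h₃ := abs_le.mp (hscale hρ (hd 2))
    simp only [f, Fin.reduceFinMk, Pi.sub_apply, Matrix.cons_val]
    rw [abs_le]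
    constructor <;> linarith
end

section
/- Let T > 0, η > 0, γ > 0, κ > 0, let ρ : [0,T] → [0,∞) be continuous, and let D, E : [0,T) → ℝ be continuous functions satisfying (η⁻¹γ)/(exp(η⁻¹γ(T−t)) − 1) ≤ D(t) ≤ κ·coth(κ(T−t)) and 0 ≤ E(t) ≤ γ⁻¹·κ·tanh(κ(T−t)) for all t ∈ [0,T). Fix t₀ ∈ [0,T) and x, y ∈ ℝ, and let X, Y : [t₀,T) → ℝ be continuously differentiable with X(t₀) = x, Y(t₀) = y, X'(s) = −D(s)X(s) + E(s)Y(s) and Y'(s) = −(ρ(s) + γE(s))Y(s) + γD(s)X(s) for s ∈ [t₀,T). Then there exists M > 0 such that |X(s)| ≤ M·(T−s) for all s ∈ [t₀,T) (in particular X(s) → 0 as s → T), and moreover the functions s ↦ D(s)X(s) and s ↦ Y(s) are bounded on [t₀,T). -/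
open Set Filter

/-- Differential Grönwall inequality on a half-open interval. -/
theorem le_mul_exp_of_hasDerivWithinAt_le_mul {f f' : ℝ → ℝ} {a b K : ℝ}
    (hf : ∀ s ∈ Ico a b, HasDerivWithinAt f (f' s) (Ico a b) s)
    (hf' : ∀ s ∈ Ico a b, f' s ≤ K * f s) :
    ∀ s ∈ Ico a b, f s ≤ f a * Real.exp (K * (s - a)) := by
  have hg : ∀ s ∈ Ico a b, HasDerivWithinAt (fun s => f s * Real.exp (-(K * (s - a))))
      ((f' s - K * f s) * Real.exp (-(K * (s - a)))) (Ico a b) s := by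
    intro s hs
    have he : HasDerivWithinAt (fun s => Real.exp (-(K * (s - a))))
        (Real.exp (-(K * (s - a))) * (-(K * 1))) (Ico a b) s :=
      ((((hasDerivAt_id s).sub_const a).const_mul K).neg.exp).hasDerivWithinAt
    exact ((hf s hs).mul he).congr_deriv (by ring)
  have hanti : AntitoneOn (fun s => f s * Real.exp (-(K * (s - a)))) (Ico a b) := by
    refine antitoneOn_of_hasDerivWithinAt_nonpos (convex_Ico a b)
      (fun s hs => (hg s hs).continuousWithinAt)
      (fun s hs => (hg s (interior_subset hs)).mono interior_subset) fun s hs => ?_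
    exact mul_nonpos_of_nonpos_of_nonneg (sub_nonpos.2 (hf' s (interior_subset hs)))
      (Real.exp_pos _).le
  intro s hs
  have h := hanti (left_mem_Ico.2 (hs.1.trans_lt hs.2)) hs hs.1
  simp only [sub_self, mul_zero, neg_zero, Real.exp_zero, mul_one, Real.exp_neg] at h
  rwa [← div_eq_mul_inv, div_le_iff₀ (Real.exp_pos _)] at h

theorem exists_bound_of_hasDerivWithinAt_le_mul {f f' : ℝ → ℝ} {a b K : ℝ}
    (hK : 0 ≤ K) (hfa : 0 ≤ f a)
    (hf : ∀ s ∈ Ico a b, HasDerivWithinAt f (f' s) (Ico a b) s)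
    (hf' : ∀ s ∈ Ico a b, f' s ≤ K * f s) :
    ∃ B, ∀ s ∈ Ico a b, f s ≤ B := by
  refine ⟨f a * Real.exp (K * (b - a)), fun s hs => ?_⟩
  refine (le_mul_exp_of_hasDerivWithinAt_le_mul hf hf' s hs).trans ?_
  have := hs.2.le
  gcongr

theorem sinh_le_mul_exp_self (z : ℝ) : Real.sinh z ≤ z * Real.exp z := by
  have h := Real.add_one_le_exp (-(2 * z))
  have h2 : Real.exp (-z) = Real.exp z * Real.exp (-(2 * z)) := by
    rw [← Real.exp_add]; ring_nf
  rw [Real.sinh_eq, h2]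
  nlinarith [Real.exp_pos z]

theorem tanh_le_mul_exp_self {z : ℝ} (hz : 0 ≤ z) : Real.tanh z ≤ z * Real.exp z := by
  rw [Real.tanh_eq_sinh_div_cosh]
  exact (div_le_self (Real.sinh_nonneg_iff.2 hz) (Real.one_le_cosh z)).trans
    (sinh_le_mul_exp_self z)

theorem self_mul_exp_neg_le (w : ℝ) : w * Real.exp (-w) ≤ 1 - Real.exp (-w) := by
  have h := mul_le_mul_of_nonneg_right (Real.add_one_le_exp w) (Real.exp_pos (-w)).le
  rw [← Real.exp_add, add_neg_cancel, Real.exp_zero] at h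
  linarith

/-- The closed-loop state is bounded if `D ≥ 0` and the other coefficients are bounded. -/
theorem exists_bound_of_closed_loop {a b γ Ebd R : ℝ} {ρ D E X Y : ℝ → ℝ}
    (hEbd : 0 ≤ Ebd) (hR : 0 ≤ R)
    (hD : ∀ s ∈ Ico a b, 0 ≤ D s) (hE : ∀ s ∈ Ico a b, |E s| ≤ Ebd)
    (hρ : ∀ s ∈ Ico a b, |ρ s| ≤ R)
    (hX : ∀ s ∈ Ico a b, HasDerivWithinAt X (-(D s * X s) + E s * Y s) (Ico a b) s)
    (hY : ∀ s ∈ Ico a b, HasDerivWithinAt Y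
      (-((ρ s + γ * E s) * Y s) + γ * D s * X s) (Ico a b) s) :
    ∃ B, 0 ≤ B ∧ ∀ s ∈ Ico a b, |Y s| ≤ B := by
  have two_mul_le {c d u v : ℝ} (h : |c| ≤ d) : 2 * (c * (u * v)) ≤ d * (u ^ 2 + v ^ 2) := by
    have := abs_le.1 h
    nlinarith [mul_nonneg (by linarith : 0 ≤ d - c) (sq_nonneg (u + v)),
      mul_nonneg (by linarith : 0 ≤ d + c) (sq_nonneg (u - v))]
  obtain ⟨W, hW⟩ : ∃ B, ∀ s ∈ Ico a b, X s ^ 2 + (γ * X s + Y s) ^ 2 ≤ B := by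
    refine exists_bound_of_hasDerivWithinAt_le_mul (K := (Ebd + R) * (3 + 2 * γ ^ 2))
      (f' := fun s => 2 * X s * (-(D s * X s) + E s * Y s)
        + 2 * (γ * X s + Y s) * (-(ρ s * Y s))) (by positivity) (by positivity) ?_ ?_
    · intro s hs
      have hZ := ((hX s hs).const_mul γ).add (hY s hs)
      exact (((hX s hs).pow 2).add (hZ.pow 2)).congr_deriv (by simp; ring)
    · intro s hs
      have h1 := two_mul_le (u := X s) (v := Y s) (hE s hs)
      have h2 := two_mul_le (c := -ρ s) (u := γ * X s + Y s) (v := Y s)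
        ((abs_neg _).trans_le (hρ s hs))
      have h3 := mul_nonneg (hD s hs) (sq_nonneg (X s))
      have hYsq : Y s ^ 2 ≤ 2 * (γ * X s + Y s) ^ 2 + 2 * γ ^ 2 * X s ^ 2 := by
        nlinarith [sq_nonneg (2 * (γ * X s) + Y s)]
      have h4 : X s ^ 2 + Y s ^ 2
          ≤ (3 + 2 * γ ^ 2) * (X s ^ 2 + (γ * X s + Y s) ^ 2) := by
        nlinarith [sq_nonneg (X s), sq_nonneg (γ * X s + Y s),
          mul_nonneg (sq_nonneg γ) (sq_nonneg (γ * X s + Y s))]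
      have h5 : (γ * X s + Y s) ^ 2 + Y s ^ 2
          ≤ (3 + 2 * γ ^ 2) * (X s ^ 2 + (γ * X s + Y s) ^ 2) := by
        nlinarith [sq_nonneg (X s), sq_nonneg (γ * X s + Y s),
          mul_nonneg (sq_nonneg γ) (sq_nonneg (γ * X s + Y s))]
      have h6 := mul_le_mul_of_nonneg_left h4 hEbd
      have h7 := mul_le_mul_of_nonneg_left h5 hR
      linarith
  refine ⟨Real.sqrt ((2 + 2 * γ ^ 2) * W), Real.sqrt_nonneg _, fun s hs => ?_⟩
  refine Real.abs_le_sqrt (le_trans ?_ (mul_le_mul_of_nonneg_left (hW s hs) (by positivity)))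
  nlinarith [sq_nonneg (2 * (γ * X s) + Y s), sq_nonneg (X s),
    mul_nonneg (sq_nonneg γ) (sq_nonneg (γ * X s + Y s))]

/-- Linear decay at `T` of a solution of `X' = -D X + F`, when `D` dominates the logarithmic
derivative of `1 - exp (-c (T - s))` and the forcing `F` vanishes linearly at `T`. -/
theorem exists_linear_decay {T a c L : ℝ} {D F X : ℝ → ℝ} (hc : 0 < c) (hL : 0 ≤ L)
    (hD : ∀ s ∈ Ico a T, c / (Real.exp (c * (T - s)) - 1) ≤ D s)
    (hF : ∀ s ∈ Ico a T, |F s| ≤ L * (T - s))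
    (hX : ∀ s ∈ Ico a T, HasDerivWithinAt X (-(D s * X s) + F s) (Ico a T) s) :
    ∃ M > 0, ∀ s ∈ Ico a T, |X s| ≤ M * (T - s) := by
  set p : ℝ → ℝ := fun s => 1 - Real.exp (-(c * (T - s))) with hp
  have hp_lb : ∀ s ∈ Ico a T, c * Real.exp (-(c * (T - a))) * (T - s) ≤ p s := by
    intro s hs
    have h0 : 0 < T - s := sub_pos.2 hs.2
    refine le_trans ?_ (self_mul_exp_neg_le (c * (T - s)))
    have h1 : Real.exp (-(c * (T - a))) ≤ Real.exp (-(c * (T - s))) := by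
      have := hs.1
      gcongr
    nlinarith [mul_le_mul_of_nonneg_left h1 (mul_pos hc h0).le]
  have hp_pos : ∀ s ∈ Ico a T, 0 < p s := fun s hs =>
    lt_of_lt_of_le (mul_pos (mul_pos hc (Real.exp_pos _)) (sub_pos.2 hs.2)) (hp_lb s hs)
  have hp_ub : ∀ s, p s ≤ c * (T - s) := fun s => by
    have := Real.add_one_le_exp (-(c * (T - s)))
    simp only [hp]
    linarith
  have hp_deriv : ∀ s, HasDerivAt p (-(c * Real.exp (-(c * (T - s))))) s := fun s =>
    ((((((hasDerivAt_id s).const_sub T).const_mul c).neg).exp).const_sub 1).congr_deriv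
      (by simp; ring)
  have hp_log : ∀ s ∈ Ico a T, c * Real.exp (-(c * (T - s)))
      = c / (Real.exp (c * (T - s)) - 1) * p s := by
    intro s hs
    have h1 : 1 < Real.exp (c * (T - s)) :=
      Real.one_lt_exp_iff.2 (mul_pos hc (sub_pos.2 hs.2))
    have h2 : Real.exp (c * (T - s)) - 1 ≠ 0 := by linarith
    simp only [hp, Real.exp_neg]
    field_simp
  set K : ℝ := L / (c * Real.exp (-(c * (T - a)))) with hK
  have hK0 : 0 ≤ K := by positivity
  have hFp : ∀ s ∈ Ico a T, |F s / p s| ≤ K := by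
    intro s hs
    rw [abs_div, abs_of_pos (hp_pos s hs), div_le_iff₀ (hp_pos s hs)]
    refine (hF s hs).trans (le_trans (le_of_eq ?_) (mul_le_mul_of_nonneg_left (hp_lb s hs) hK0))
    rw [hK]
    field_simp
  obtain ⟨B, hB⟩ : ∃ B, ∀ s ∈ Ico a T, (X s / p s) ^ 2 + 1 ≤ B := by
    refine exists_bound_of_hasDerivWithinAt_le_mul (K := K)
      (f' := fun s => 2 * (X s / p s) *
        (-((D s - c / (Real.exp (c * (T - s)) - 1)) * (X s / p s)) + F s / p s))
      hK0 (by positivity) ?_ ?_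
    · intro s hs
      have hne := (hp_pos s hs).ne'
      refine ((((hX s hs).div (hp_deriv s).hasDerivWithinAt hne).pow 2).add_const 1).congr_deriv ?_
      rw [hp_log s hs]
      generalize c / (Real.exp (c * (T - s)) - 1) = d
      simp only [Pi.div_apply, Nat.add_one_sub_one, pow_one, Nat.cast_ofNat]
      field_simp
      ring
    · intro s hs
      have h1 := mul_nonneg (sub_nonneg.2 (hD s hs)) (sq_nonneg (X s / p s))
      have h2 := abs_le.1 (hFp s hs)
      nlinarith [mul_nonneg (by linarith : 0 ≤ K - F s / p s) (sq_nonneg (X s / p s + 1)),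
        mul_nonneg (by linarith : 0 ≤ K + F s / p s) (sq_nonneg (X s / p s - 1))]
  refine ⟨(Real.sqrt B + 1) * c, by positivity, fun s hs => ?_⟩
  have h1 : |X s / p s| ≤ Real.sqrt B + 1 := by
    have := Real.abs_le_sqrt (x := X s / p s) (y := B) (by linarith [hB s hs])
    linarith
  rw [abs_div, abs_of_pos (hp_pos s hs), div_le_iff₀ (hp_pos s hs)] at h1
  rw [mul_assoc]
  exact h1.trans (mul_le_mul_of_nonneg_left (hp_ub s) (by positivity))

theorem mul_coth_mul_le {κ r T : ℝ} (hκ : 0 < κ) (hr : 0 < r) (hrT : r ≤ T) :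
    κ * (Real.cosh (κ * r) / Real.sinh (κ * r)) * r ≤ Real.cosh (κ * T) := by
  have hz : 0 < κ * r := mul_pos hκ hr
  have hs : 0 < Real.sinh (κ * r) := Real.sinh_pos_iff.2 hz
  have h1 : κ * r ≤ Real.sinh (κ * r) := Real.self_le_sinh_iff.2 hz.le
  have h2 : Real.cosh (κ * r) ≤ Real.cosh (κ * T) := by
    rw [Real.cosh_le_cosh, abs_of_pos hz, abs_of_pos (by nlinarith)]
    gcongr
  calc κ * (Real.cosh (κ * r) / Real.sinh (κ * r)) * r
      = κ * r * Real.cosh (κ * r) / Real.sinh (κ * r) := by ring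
    _ ≤ Real.sinh (κ * r) * Real.cosh (κ * r) / Real.sinh (κ * r) := by
        have := Real.cosh_pos (κ * r)
        gcongr
    _ = Real.cosh (κ * r) := by field_simp
    _ ≤ Real.cosh (κ * T) := h2

/-- Admissibility of the candidate optimal feedback control: with the
barrier estimates on the feedback coefficients `D` and `E`, the closed-loop
state `(X,Y)` satisfies `|X(s)| ≤ M(T−s)` (so `X(s) → 0` as `s → T`), and
`D·X` and `Y` stay bounded up to the terminal time. -/
theorem stmt_11 (T η γ κ : ℝ) (hT : 0 < T) (hη : 0 < η) (hγ : 0 < γ)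
    (hκ : 0 < κ)
    (ρ : ℝ → ℝ) (hρ_cont : ContinuousOn ρ (Icc 0 T))
    (hρ_nonneg : ∀ t ∈ Icc (0 : ℝ) T, 0 ≤ ρ t)
    (D E : ℝ → ℝ)
    (hD_cont : ContinuousOn D (Ico 0 T)) (hE_cont : ContinuousOn E (Ico 0 T))
    (hD_lb : ∀ t ∈ Ico (0 : ℝ) T,
      (η⁻¹ * γ) / (Real.exp (η⁻¹ * γ * (T - t)) - 1) ≤ D t)
    (hD_ub : ∀ t ∈ Ico (0 : ℝ) T,
      D t ≤ κ * (Real.cosh (κ * (T - t)) / Real.sinh (κ * (T - t))))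
    (hE_lb : ∀ t ∈ Ico (0 : ℝ) T, 0 ≤ E t)
    (hE_ub : ∀ t ∈ Ico (0 : ℝ) T, E t ≤ γ⁻¹ * κ * Real.tanh (κ * (T - t)))
    (t₀ x y : ℝ) (ht₀ : t₀ ∈ Ico (0 : ℝ) T)
    (X Y : ℝ → ℝ) (hX0 : X t₀ = x) (hY0 : Y t₀ = y)
    (hX : ∀ s ∈ Ico t₀ T, HasDerivWithinAt X
      (-(D s * X s) + E s * Y s) (Ico t₀ T) s)
    (hY : ∀ s ∈ Ico t₀ T, HasDerivWithinAt Y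
      (-((ρ s + γ * E s) * Y s) + γ * D s * X s) (Ico t₀ T) s) :
    (∃ M > 0, ∀ s ∈ Ico t₀ T, |X s| ≤ M * (T - s))
      ∧ Tendsto X (nhdsWithin T (Iio T)) (nhds 0)
      ∧ ∃ M' : ℝ, ∀ s ∈ Ico t₀ T, |D s * X s| ≤ M' ∧ |Y s| ≤ M' := by
  have hsub : ∀ s ∈ Ico t₀ T, s ∈ Ico (0 : ℝ) T := fun s hs => ⟨ht₀.1.trans hs.1, hs.2⟩
  have hc : 0 < η⁻¹ * γ := by positivity
  have hD_nonneg : ∀ s ∈ Ico t₀ T, 0 ≤ D s := fun s hs =>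
    le_trans (div_nonneg hc.le (sub_nonneg.2 (Real.one_le_exp
      (mul_nonneg hc.le (sub_nonneg.2 hs.2.le))))) (hD_lb s (hsub s hs))
  set C : ℝ := γ⁻¹ * κ * (κ * Real.exp (κ * T)) with hC
  have hC0 : 0 ≤ C := by positivity
  have hE_lin : ∀ s ∈ Ico t₀ T, |E s| ≤ C * (T - s) := by
    intro s hs
    have h0 : 0 ≤ T - s := sub_nonneg.2 hs.2.le
    have h1 : T - s ≤ T := by linarith [(hsub s hs).1]
    rw [abs_of_nonneg (hE_lb s (hsub s hs))]
    calc E s ≤ γ⁻¹ * κ * Real.tanh (κ * (T - s)) := hE_ub s (hsub s hs)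
      _ ≤ γ⁻¹ * κ * (κ * (T - s) * Real.exp (κ * (T - s))) := by
          gcongr
          exact tanh_le_mul_exp_self (by positivity)
      _ ≤ γ⁻¹ * κ * (κ * (T - s) * Real.exp (κ * T)) := by gcongr
      _ = C * (T - s) := by rw [hC]; ring
  obtain ⟨R, hR⟩ := isCompact_Icc.exists_bound_of_continuousOn hρ_cont
  obtain ⟨B, hB0, hB⟩ := exists_bound_of_closed_loop (Ebd := C * T) (R := R) (by positivity)
    ((norm_nonneg _).trans (hR 0 (left_mem_Icc.2 hT.le))) hD_nonneg
    (fun s hs => (hE_lin s hs).trans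
      (mul_le_mul_of_nonneg_left (by linarith [(hsub s hs).1]) hC0))
    (fun s hs => hR s (Ico_subset_Icc_self (hsub s hs))) hX hY
  obtain ⟨M, hM0, hM⟩ := exists_linear_decay (L := C * B) (F := fun s => E s * Y s) hc
    (by positivity) (fun s hs => hD_lb s (hsub s hs))
    (fun s hs => by
      rw [abs_mul, mul_right_comm]
      exact mul_le_mul (hE_lin s hs) (hB s hs) (abs_nonneg _) ((abs_nonneg _).trans (hE_lin s hs)))
    hX
  refine ⟨⟨M, hM0, hM⟩, ?_, max (Real.cosh (κ * T) * M) B, fun s hs =>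
    ⟨le_max_of_le_left ?_, le_max_of_le_right (hB s hs)⟩⟩
  · have hlim : Tendsto (fun s => M * (T - s)) (nhdsWithin T (Iio T)) (nhds 0) := by
      have : ContinuousAt (fun s => M * (T - s)) T := by fun_prop
      simpa [ContinuousAt] using this.tendsto.mono_left nhdsWithin_le_nhds
    refine squeeze_zero_norm' ?_ hlim
    filter_upwards [Ico_mem_nhdsLT ht₀.2] with s hs using hM s hs
  · have h0 : 0 < T - s := sub_pos.2 hs.2
    have hDs : D s * (T - s) ≤ Real.cosh (κ * T) :=
      (mul_le_mul_of_nonneg_right (hD_ub s (hsub s hs)) h0.le).trans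
        (mul_coth_mul_le hκ h0 (by linarith [(hsub s hs).1]))
    rw [abs_mul, abs_of_nonneg (hD_nonneg s hs)]
    calc D s * |X s| ≤ D s * (M * (T - s)) :=
          mul_le_mul_of_nonneg_left (hM s hs) (hD_nonneg s hs)
      _ = D s * (T - s) * M := by ring
      _ ≤ Real.cosh (κ * T) * M := mul_le_mul_of_nonneg_right hDs hM0.le
end

section
/- Let t < T be reals, let ξ : [t,T] → ℝ be square-integrable, and define X(s) = ∫ₛᵀ ξ(r) dr for s ∈ [t,T]. Let A : [t,T) → ℝ be a function with sup_{s ∈ [t,T)} (T−s)·|A(s)| < ∞. Then A(s)·X(s)² → 0 as s → T. -/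
open MeasureTheory intervalIntegral Set Filter

/-- Cauchy–Schwarz against the constant function `1` on an interval. -/
theorem sq_intervalIntegral_le {f : ℝ → ℝ} {a b : ℝ} (hab : a < b)
    (hf : IntervalIntegrable f volume a b)
    (hf2 : IntervalIntegrable (fun x => f x ^ 2) volume a b) :
    (∫ x in a..b, f x) ^ 2 ≤ (b - a) * ∫ x in a..b, f x ^ 2 := by
  have hba : 0 < b - a := sub_pos.2 hab
  set I := ∫ x in a..b, f x with hI
  have hnonneg : 0 ≤ ∫ x in a..b, ((b - a) * f x - I) ^ 2 :=
    integral_nonneg hab.le fun x _ => sq_nonneg _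
  have hexpand : ∫ x in a..b, ((b - a) * f x - I) ^ 2 =
      (b - a) * ((b - a) * (∫ x in a..b, f x ^ 2) - I ^ 2) := by
    have hpoint : (fun x => ((b - a) * f x - I) ^ 2) =
        fun x => (b - a) ^ 2 * f x ^ 2 - 2 * (b - a) * I * f x + I ^ 2 := by
      ext x; ring
    rw [hpoint, integral_add ((hf2.const_mul _).sub (hf.const_mul _))
      intervalIntegrable_const, integral_sub (hf2.const_mul _) (hf.const_mul _),
      intervalIntegral.integral_const_mul, intervalIntegral.integral_const_mul,
      intervalIntegral.integral_const, smul_eq_mul, ← hI]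
    ring
  rw [hexpand] at hnonneg
  exact sub_nonneg.1 (nonneg_of_mul_nonneg_right hnonneg hba)

/-- If `ξ` is square-integrable on `[t,T]`, `X(s) = ∫ₛᵀ ξ`, and
`(T−s)·|A(s)|` is bounded on `[t,T)`, then `A(s)·X(s)² → 0` as `s → T`. -/
theorem stmt_12 (t T : ℝ) (htT : t < T) (ξ : ℝ → ℝ)
    (hξ : IntervalIntegrable ξ volume t T)
    (hξ2 : IntervalIntegrable (fun r => ξ r ^ 2) volume t T)
    (A : ℝ → ℝ) (hA : ∃ M : ℝ, ∀ s ∈ Ico t T, (T - s) * |A s| ≤ M) :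
    Tendsto (fun s => A s * (∫ r in s..T, ξ r) ^ 2)
      (nhdsWithin T (Iio T)) (nhds 0) := by
  obtain ⟨M, hM⟩ := hA
  have htail : Tendsto (fun s => ∫ r in s..T, ξ r ^ 2) (nhdsWithin T (Iio T)) (nhds 0) := by
    have hξ2_on : IntegrableOn (fun r => ξ r ^ 2) (uIcc t T) volume := by
      rwa [uIcc_of_le htT.le, ← intervalIntegrable_iff_integrableOn_Icc_of_le htT.le]
    have hcont := continuousOn_primitive_interval_left hξ2_on T right_mem_uIcc
    rw [ContinuousWithinAt, integral_same, uIcc_of_le htT.le] at hcont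
    rw [← nhdsWithin_Ico_eq_nhdsLT htT]
    exact hcont.mono_left (nhdsWithin_mono _ Ico_subset_Icc_self)
  refine squeeze_zero_norm' ?_ (by simpa using htail.const_mul M)
  filter_upwards [Ico_mem_nhdsLT htT] with s hs
  have hsub : uIcc s T ⊆ uIcc t T := uIcc_subset_uIcc (by
    rw [uIcc_of_le htT.le]; exact Ico_subset_Icc_self hs) right_mem_uIcc
  have hCS := sq_intervalIntegral_le hs.2 (hξ.mono_set hsub) (hξ2.mono_set hsub)
  have htail_nonneg : 0 ≤ ∫ r in s..T, ξ r ^ 2 := integral_nonneg hs.2.le fun r _ => sq_nonneg _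
  calc ‖A s * (∫ r in s..T, ξ r) ^ 2‖ = |A s| * (∫ r in s..T, ξ r) ^ 2 := by
        rw [norm_mul, Real.norm_eq_abs, Real.norm_of_nonneg (sq_nonneg _)]
    _ ≤ |A s| * ((T - s) * ∫ r in s..T, ξ r ^ 2) := by gcongr
    _ = (T - s) * |A s| * ∫ r in s..T, ξ r ^ 2 := by ring
    _ ≤ M * ∫ r in s..T, ξ r ^ 2 := by gcongr; exact hM s hs
end
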